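/- arXiv:1603.05995 — 10 statements merged into one kernel-verified Lean document; each statement's English description precedes it below -/
import Mathlib

section
/- Let X be a topological space, K a compact Hausdorff topological space, and f : X × K → K a continuous map such that for each x ∈ X the map f_x := f(x, ·) : K → K is bijective. Then the map g : X × K → K, g(x, z) := (f_x)⁻¹(z) is continuous, and the map h : X × K → X × K, h(x, y) := (x, f(x, y)) is a homeomorphism. -/
/-- Let `X` be a topological space, `K` a compact Hausdorff space and
`f : X × K → K` a continuous map such that `f x := f (x, ·)` is bijective for
each `x ∈ X`.  Then the map `g : X × K → K`, `g (x, z) = (f x)⁻¹ z` is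
continuous, and `h : X × K → X × K`, `h (x, y) = (x, f (x, y))` is a
homeomorphism. -/
theorem continuous_inverse_and_isHomeomorph
    {X K : Type*} [TopologicalSpace X] [TopologicalSpace K]
    [CompactSpace K] [T2Space K]
    (f : X × K → K) (hf : Continuous f)
    (hbij : ∀ x : X, Function.Bijective fun y : K => f (x, y)) :
    Continuous (fun p : X × K =>
      (Equiv.ofBijective _ (hbij p.1)).symm p.2) ∧
    IsHomeomorph (fun p : X × K => (p.1, f p)) := by
  have apply_inv (p : X × K) : f (p.1, (Equiv.ofBijective _ (hbij p.1)).symm p.2) = p.2 :=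
    (Equiv.ofBijective _ (hbij p.1)).apply_symm_apply p.2
  have inv_apply (x : X) (y : K) : (Equiv.ofBijective _ (hbij x)).symm (f (x, y)) = y :=
    (Equiv.ofBijective _ (hbij x)).symm_apply_apply y
  have hg : Continuous (fun p : X × K => (Equiv.ofBijective _ (hbij p.1)).symm p.2) := by
    refine continuous_iff_isClosed.2 fun C hC => ?_
    have hS : IsClosed {q : (X × K) × K | f (q.1.1, q.2) = q.1.2 ∧ q.2 ∈ C} :=
      (isClosed_eq (by fun_prop) (by fun_prop)).inter (hC.preimage continuous_snd)
    convert isClosedMap_fst_of_compactSpace _ hS using 1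
    ext ⟨x, z⟩
    constructor
    · intro h
      exact ⟨((x, z), _), ⟨apply_inv (x, z), h⟩, rfl⟩
    · rintro ⟨⟨⟨x', z'⟩, y⟩, ⟨hy, hyC⟩, h⟩
      obtain ⟨rfl, rfl⟩ := Prod.mk.inj h
      obtain rfl : f (x', y) = z' := hy
      simpa only [Set.mem_preimage, inv_apply] using hyC
  refine ⟨hg, isHomeomorph_iff_exists_inverse.2 ⟨by fun_prop,
    fun p => (p.1, (Equiv.ofBijective _ (hbij p.1)).symm p.2), ?_, ?_,
    continuous_fst.prodMk hg⟩⟩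
  · rintro ⟨x, y⟩
    exact Prod.ext rfl (inv_apply x y)
  · intro p
    exact Prod.ext rfl (apply_inv p)
end

section
/- Let E and F be real Banach spaces, U ⊆ E a convex subset with non-empty interior, and f : U × F → F a smooth map (infinitely differentiable on the set U × F in the sense of ContDiffOn) such that for each x ∈ U the map f_x := f(x, ·) : F → F is linear and bijective. If the map g : U × F → F, g(x, z) := (f_x)⁻¹(z) is continuous, then g is smooth on U × F. -/
/-- A linear map which is differentiable at the origin agrees with its derivative there. -/
theorem IsLinearMap.eq_of_hasFDerivAt_zero {F G : Type*} [NormedAddCommGroup F] [NormedSpace ℝ F]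
    [NormedAddCommGroup G] [NormedSpace ℝ G] {h : F → G} (hlin : IsLinearMap ℝ h)
    {A : F →L[ℝ] G} (hA : HasFDerivAt h A 0) (z : F) : A z = h z := by
  have hc : Continuous (hlin.mk' h) :=
    continuous_of_continuousAt_zero (hlin.mk' h) hA.continuousAt
  let L : F →L[ℝ] G := ⟨hlin.mk' h, hc⟩
  have hL : HasFDerivAt h L 0 := L.hasFDerivAt
  rw [hA.unique hL]
  rfl

/-- Let `E` and `F` be real Banach spaces, `U ⊆ E` a convex subset with
non-empty interior, and `f : U × F → F` a smooth map such that each partial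
map `f x := f (x, ·) : F → F` is linear and bijective for `x ∈ U`.  If the
map `g : U × F → F` sending `(x, z)` to `(f x)⁻¹ z` is continuous, then `g`
is smooth on `U × F`. -/
theorem contDiffOn_inverse_of_linear_bijective_parameters
    {E F : Type*} [NormedAddCommGroup E] [NormedSpace ℝ E] [CompleteSpace E]
    [NormedAddCommGroup F] [NormedSpace ℝ F] [CompleteSpace F]
    (U : Set E) (hU : Convex ℝ U) (hUint : (interior U).Nonempty)
    (f g : E × F → F)
    (hf : ContDiffOn ℝ (⊤ : ℕ∞) f (U ×ˢ (Set.univ : Set F)))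
    (hlin : ∀ x ∈ U, IsLinearMap ℝ (fun z : F => f (x, z)))
    (hbij : ∀ x ∈ U, Function.Bijective (fun z : F => f (x, z)))
    (hginv : ∀ x ∈ U, ∀ z : F, f (x, g (x, z)) = z ∧ g (x, f (x, z)) = z)
    (hgcont : ContinuousOn g (U ×ˢ (Set.univ : Set F))) :
    ContDiffOn ℝ (⊤ : ℕ∞) g (U ×ˢ (Set.univ : Set F)) := by
  have hs : UniqueDiffOn ℝ (U ×ˢ (Set.univ : Set F)) :=
    (uniqueDiffOn_convex hU hUint).prod uniqueDiffOn_univ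
  let A : E → F →L[ℝ] F := fun x =>
    (fderivWithin ℝ f (U ×ˢ Set.univ) (x, 0)).comp (ContinuousLinearMap.inr ℝ E F)
  have hA : ContDiffOn ℝ (⊤ : ℕ∞) A U := by
    have h := hf.fderivWithin (m := ((⊤ : ℕ∞) : WithTop ℕ∞)) hs le_rfl
    have h' : ContDiffOn ℝ (⊤ : ℕ∞)
        (fun x : E => fderivWithin ℝ f (U ×ˢ Set.univ) (x, (0 : F))) U :=
      h.comp (contDiff_id.prodMk contDiff_const).contDiffOn fun x hx => ⟨hx, Set.mem_univ _⟩
    exact h'.clm_comp contDiffOn_const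
  have hAf : ∀ x ∈ U, ∀ z, A x z = f (x, z) := fun x hx =>
    (hlin x hx).eq_of_hasFDerivAt_zero <| by
      have hd := (hf.differentiableOn (by simp) (x, 0) ⟨hx, Set.mem_univ _⟩).hasFDerivWithinAt
      exact (hd.comp (0 : F) (hasFDerivAt_prodMk_right x (0 : F)).hasFDerivWithinAt
        (fun z _ => ⟨hx, Set.mem_univ _⟩)).hasFDerivAt Filter.univ_mem
  have hAe : ∀ x ∈ U, ∃ e : F ≃L[ℝ] F, (e : F →L[ℝ] F) = A x := fun x hx => by
    have hb : Function.Bijective (A x) := (funext (hAf x hx) : ⇑(A x) = _) ▸ hbij x hx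
    exact ⟨ContinuousLinearEquiv.ofBijective (A x) (LinearMap.ker_eq_bot.2 hb.1)
      (LinearMap.range_eq_top.2 hb.2), ContinuousLinearEquiv.coe_ofBijective ..⟩
  have hinv : ContDiffOn ℝ (⊤ : ℕ∞) (fun x => (A x).inverse) U := fun x hx => by
    obtain ⟨e, he⟩ := hAe x hx
    exact ContDiffAt.comp_contDiffWithinAt x (he ▸ contDiffAt_map_inverse e) (hA x hx)
  have hG : ContDiffOn ℝ (⊤ : ℕ∞) (fun p : E × F => (A p.1).inverse p.2) (U ×ˢ Set.univ) :=
    (hinv.comp contDiff_fst.contDiffOn fun p hp => hp.1).clm_apply contDiff_snd.contDiffOn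
  refine hG.congr fun p hp => ?_
  obtain ⟨e, he⟩ := hAe p.1 hp.1
  rw [← he, ContinuousLinearMap.inverse_equiv]
  refine (e.symm_apply_eq.2 ?_).symm
  rw [← ContinuousLinearEquiv.coe_coe, he, hAf p.1 hp.1]
  exact (hginv p.1 hp.1 p.2).1.symm
end

section
/- Let E be a real normed space, F a real Banach space, P ⊆ E and V ⊆ F convex subsets with non-empty interior, θ < 1, and f : P × V → F a smooth map (infinitely differentiable on P × V in the sense of ContDiffOn) such that for each p ∈ P the map f_p := f(p, ·) : V → F is Lipschitz with Lipschitz constant at most θ. Assume that for each p ∈ P the map f_p has a fixed point x_p ∈ V (necessarily unique), and let φ : P → V, φ(p) := x_p. If φ is continuous, then φ is smooth on P. -/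
open Set Filter Topology Asymptotics

section FixedPoint

variable {E F : Type*} [NormedAddCommGroup E] [NormedSpace ℝ E]
  [NormedAddCommGroup F] [NormedSpace ℝ F]

/-- The partial derivative in the second variable of a `C¹` map is bounded by any Lipschitz
constant in that variable, also at boundary points of the convex set `V`. -/
theorem norm_fderivWithin_prod_comp_inr_le
    {P : Set E} {V : Set F} (hV : Convex ℝ V) (hVint : (interior V).Nonempty)
    {C : ℝ} (hC : 0 ≤ C) {f : E × F → F} (hf : DifferentiableOn ℝ f (P ×ˢ V))
    (hf' : ContinuousOn (fderivWithin ℝ f (P ×ˢ V)) (P ×ˢ V))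
    {p : E} (hp : p ∈ P)
    (hlip : ∀ x ∈ V, ∀ y ∈ V, ‖f (p, y) - f (p, x)‖ ≤ C * ‖y - x‖)
    {x : F} (hx : x ∈ V) :
    ‖(fderivWithin ℝ f (P ×ˢ V) (p, x)).comp (ContinuousLinearMap.inr ℝ E F)‖ ≤ C := by
  have maps : MapsTo (fun y : F => (p, y)) V (P ×ˢ V) := fun y hy => ⟨hp, hy⟩
  have bound : ∀ y ∈ interior V,
      ‖(fderivWithin ℝ f (P ×ˢ V) (p, y)).comp (ContinuousLinearMap.inr ℝ E F)‖ ≤ C := by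
    intro y hy
    have hyV : V ∈ 𝓝 y := mem_interior_iff_mem_nhds.mp hy
    have hd : HasFDerivAt (fun y => f (p, y))
        ((fderivWithin ℝ f (P ×ˢ V) (p, y)).comp (ContinuousLinearMap.inr ℝ E F)) y :=
      (((hf (p, y) ⟨hp, interior_subset hy⟩).hasFDerivWithinAt).comp y
        (hasFDerivAt_prodMk_right p y).hasFDerivWithinAt maps).hasFDerivAt hyV
    refine hd.le_of_lip' hC ?_
    filter_upwards [hyV] with z hz using hlip y (interior_subset hy) z hz
  have hcont : ContinuousWithinAt (fun y =>
      ‖(fderivWithin ℝ f (P ×ˢ V) (p, y)).comp (ContinuousLinearMap.inr ℝ E F)‖)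
      (interior V) x := by
    have h : ContinuousOn (fun y => fderivWithin ℝ f (P ×ˢ V) (p, y)) V :=
      hf'.comp (by fun_prop) maps
    exact (((h x hx).clm_comp continuousWithinAt_const).norm).mono interior_subset
  have hxcl : x ∈ closure (interior V) := by
    rw [hV.closure_interior_eq_closure_of_nonempty_interior hVint]
    exact subset_closure hx
  have := mem_closure_iff_nhdsWithin_neBot.mp hxcl
  exact le_of_tendsto hcont (eventually_nhdsWithin_of_forall bound)

/-- Implicit differentiation of a continuous family of fixed points, within sets. -/
theorem hasFDerivWithinAt_fixedPoint
    {P : Set E} {V : Set F} {f : E × F → F} {φ : E → F} {p : E} (hp : p ∈ P)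
    {L : E × F →L[ℝ] F} (hL : HasFDerivWithinAt f L (P ×ˢ V) (p, φ p))
    (hunit : IsUnit (1 - L.comp (ContinuousLinearMap.inr ℝ E F)))
    (hφV : ∀ q ∈ P, φ q ∈ V) (hfix : ∀ q ∈ P, f (q, φ q) = φ q)
    (hφ : ContinuousWithinAt φ P p) :
    HasFDerivWithinAt φ
      ((Ring.inverse (1 - L.comp (ContinuousLinearMap.inr ℝ E F))).comp
        (L.comp (ContinuousLinearMap.inl ℝ E F))) P p := by
  set B := Ring.inverse (1 - L.comp (ContinuousLinearMap.inr ℝ E F)) with hB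
  have hBmul (v : F) : B (v - L (0, v)) = v :=
    congrArg (fun T : F →L[ℝ] F => T v) (Ring.inverse_mul_cancel _ hunit)
  have htend : Tendsto (fun q => (q, φ q)) (𝓝[P] p) (𝓝[P ×ˢ V] (p, φ p)) :=
    tendsto_nhdsWithin_iff.mpr ⟨continuousWithinAt_id.prodMk hφ,
      eventually_nhdsWithin_of_forall fun q hq => ⟨hq, hφV q hq⟩⟩
  have hlo : (fun q => φ q - φ p - (B.comp (L.comp (ContinuousLinearMap.inl ℝ E F))) (q - p))
      =o[𝓝[P] p] fun q => (q - p, φ q - φ p) := by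
    have h := (hasFDerivWithinAt_iff_isLittleO.mp hL).comp_tendsto htend
    refine ((B.isBigO_comp _ _).trans_isLittleO h).congr' ?_ (.of_forall fun q => rfl)
    filter_upwards [self_mem_nhdsWithin] with q hq
    have hsplit : L (q - p, φ q - φ p) = L (q - p, 0) + L (0, φ q - φ p) := by
      rw [← map_add]; simp
    simp only [Function.comp_apply, hfix q hq, hfix p hp, Prod.mk_sub_mk, hsplit]
    rw [show φ q - φ p - (L (q - p, 0) + L (0, φ q - φ p))
      = (φ q - φ p - L (0, φ q - φ p)) - L (q - p, 0) by abel, map_sub, hBmul]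
    simp
  have hbig : (fun q => φ q - φ p) =O[𝓝[P] p] fun q => q - p := by
    refine IsBigO.of_bound (2 * ‖B.comp (L.comp (ContinuousLinearMap.inl ℝ E F))‖ + 1) ?_
    filter_upwards [hlo.bound (show (0 : ℝ) < 1 / 2 by norm_num)] with q hq
    have h1 := (B.comp (L.comp (ContinuousLinearMap.inl ℝ E F))).le_opNorm (q - p)
    have h2 := norm_le_norm_add_norm_sub'
      (φ q - φ p) ((B.comp (L.comp (ContinuousLinearMap.inl ℝ E F))) (q - p))
    have h3 : ‖(q - p, φ q - φ p)‖ ≤ ‖q - p‖ + ‖φ q - φ p‖ :=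
      max_le_add_of_nonneg (norm_nonneg _) (norm_nonneg _)
    linarith
  exact hasFDerivWithinAt_iff_isLittleO.mpr
    (hlo.trans_isBigO ((isBigO_refl _ _).prod_left hbig))

end FixedPoint


/-- Parameter-dependence of fixed points, smooth case:  let `E` be a real
normed space, `F` a real Banach space, `P ⊆ E` and `V ⊆ F` convex subsets
with non-empty interior, `θ < 1`, and `f : P × V → F` a smooth map such that
each `f p := f (p, ·)` is Lipschitz with constant at most `θ`.  If each `f p`
has a fixed point `φ p ∈ V` and `φ` is continuous, then `φ` is smooth. -/
theorem contDiffOn_fixedPoint_of_continuous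
    {E F : Type*} [NormedAddCommGroup E] [NormedSpace ℝ E]
    [NormedAddCommGroup F] [NormedSpace ℝ F] [CompleteSpace F]
    (P : Set E) (hP : Convex ℝ P) (hPint : (interior P).Nonempty)
    (V : Set F) (hV : Convex ℝ V) (hVint : (interior V).Nonempty)
    (θ : ℝ) (hθ : θ < 1)
    (f : E × F → F) (hf : ContDiffOn ℝ (⊤ : ℕ∞) f (P ×ˢ V))
    (hlip : ∀ p ∈ P, ∀ x ∈ V, ∀ y ∈ V, ‖f (p, y) - f (p, x)‖ ≤ θ * ‖y - x‖)
    (φ : E → F) (hφV : ∀ p ∈ P, φ p ∈ V)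
    (hfix : ∀ p ∈ P, f (p, φ p) = φ p)
    (hφcont : ContinuousOn φ P) :
    ContDiffOn ℝ (⊤ : ℕ∞) φ P := by
  have hPu : UniqueDiffOn ℝ P := uniqueDiffOn_convex hP hPint
  have hVu : UniqueDiffOn ℝ V := uniqueDiffOn_convex hV hVint
  have hPV : UniqueDiffOn ℝ (P ×ˢ V) := hPu.prod hVu
  have hdf : DifferentiableOn ℝ f (P ×ˢ V) := hf.differentiableOn (by simp)
  have hf' : ContDiffOn ℝ (⊤ : ℕ∞) (fderivWithin ℝ f (P ×ˢ V)) (P ×ˢ V) :=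
    hf.fderivWithin hPV (by simp)
  have hunit : ∀ p ∈ P, IsUnit (1 - (fderivWithin ℝ f (P ×ˢ V) (p, φ p)).comp
      (ContinuousLinearMap.inr ℝ E F)) := by
    intro p hp
    refine isUnit_one_sub_of_norm_lt_one (lt_of_le_of_lt
      (norm_fderivWithin_prod_comp_inr_le hV hVint (le_max_right θ 0) hdf hf'.continuousOn hp
        (fun x hx y hy => (hlip p hp x hx y hy).trans ?_) (hφV p hp)) (max_lt hθ one_pos))
    gcongr
    exact le_max_left _ _
  have hderiv := fun p (hp : p ∈ P) => hasFDerivWithinAt_fixedPoint hp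
    (hdf (p, φ p) ⟨hp, hφV p hp⟩).hasFDerivWithinAt (hunit p hp) hφV hfix (hφcont p hp)
  refine contDiffOn_infty.mpr fun n => ?_
  induction n with
  | zero => exact contDiffOn_zero.mpr hφcont
  | succ n ih =>
    push_cast
    refine (contDiffOn_succ_iff_fderivWithin hPu).mpr
      ⟨fun p hp => (hderiv p hp).differentiableWithinAt, by simp, ?_⟩
    have hM : ContDiffOn ℝ n (fun p => fderivWithin ℝ f (P ×ˢ V) (p, φ p)) P :=
      (contDiffOn_infty.mp hf' n).comp (contDiffOn_id.prodMk ih) fun p hp => ⟨hp, hφV p hp⟩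
    have hinv : ContDiffOn ℝ n (fun p => Ring.inverse
        (1 - (fderivWithin ℝ f (P ×ˢ V) (p, φ p)).comp (ContinuousLinearMap.inr ℝ E F))) P := by
      intro p hp
      obtain ⟨u, hu⟩ := hunit p hp
      have hring := contDiffAt_ringInverse ℝ (n := n) u
      rw [hu] at hring
      exact hring.comp_contDiffWithinAt p
        ((contDiffOn_const.sub (hM.clm_comp contDiffOn_const)) p hp)
    exact (hinv.clm_comp (hM.clm_comp contDiffOn_const)).congr
      fun p hp => (hderiv p hp).fderivWithin (hPu p hp)
end

section
/- Let E be a real normed space, F a real Banach space, P ⊆ E and V ⊆ F convex subsets with non-empty interior, θ < 1, and f : P × V → F a map that is continuously differentiable on P × V (C¹ in the sense of ContDiffOn) such that for each p ∈ P the map f_p := f(p, ·) : V → F is Lipschitz with Lipschitz constant at most θ. Assume each f_p has a (necessarily unique) fixed point x_p ∈ V and that the map φ : P → V, φ(p) := x_p, is continuous. Then φ is continuously differentiable (C¹) on P. -/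
/-- The second partial derivative of a `C¹` map on `P ×ˢ V` is bounded by a Lipschitz constant
of the partial maps, also at boundary points of the convex set `V`. -/
theorem norm_fderivWithin_comp_inr_le
    {E F G : Type*} [NormedAddCommGroup E] [NormedSpace ℝ E]
    [NormedAddCommGroup F] [NormedSpace ℝ F] [NormedAddCommGroup G] [NormedSpace ℝ G]
    {P : Set E} {V : Set F} (hV : Convex ℝ V) (hVint : (interior V).Nonempty)
    {K : ℝ} (hK : 0 ≤ K) {f : E × F → G} (hd : DifferentiableOn ℝ f (P ×ˢ V))
    (hc : ContinuousOn (fderivWithin ℝ f (P ×ˢ V)) (P ×ˢ V))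
    {p : E} (hp : p ∈ P)
    (hlip : ∀ x ∈ V, ∀ y ∈ V, ‖f (p, y) - f (p, x)‖ ≤ K * ‖y - x‖) {x : F} (hx : x ∈ V) :
    ‖(fderivWithin ℝ f (P ×ˢ V) (p, x)).comp (ContinuousLinearMap.inr ℝ E F)‖ ≤ K := by
  set B : F → F →L[ℝ] G := fun y =>
    (fderivWithin ℝ f (P ×ˢ V) (p, y)).comp (ContinuousLinearMap.inr ℝ E F)
  have hmaps : Set.MapsTo (fun y : F => (p, y)) V (P ×ˢ V) := fun y hy => ⟨hp, hy⟩
  have hBc : ContinuousOn B V :=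
    (hc.comp (by fun_prop) hmaps).clm_comp continuousOn_const
  have hBint : ∀ y ∈ interior V, ‖B y‖ ≤ K := by
    intro y hy
    have hyV := interior_subset hy
    have h1 : HasFDerivWithinAt (fun z : F => f (p, z)) (B y) V y :=
      (hd (p, y) ⟨hp, hyV⟩).hasFDerivWithinAt.comp y
        (hasFDerivAt_prodMk_right p y).hasFDerivWithinAt hmaps
    have h2 := h1.hasFDerivAt (mem_interior_iff_mem_nhds.1 hy)
    refine h2.le_of_lip' hK ?_
    filter_upwards [mem_interior_iff_mem_nhds.1 hy] with z hz using hlip y hyV z hz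
  have hxcl : x ∈ closure (interior V) := by
    rw [hV.closure_interior_eq_closure_of_nonempty_interior hVint]
    exact subset_closure hx
  have : (nhdsWithin x (interior V)).NeBot := mem_closure_iff_nhdsWithin_neBot.1 hxcl
  have ht : Filter.Tendsto (fun y => ‖B y‖) (nhdsWithin x (interior V)) (nhds ‖B x‖) :=
    ((hBc x hx).mono interior_subset).norm
  exact le_of_tendsto ht (eventually_nhdsWithin_of_forall hBint)

/-- Differentiability part of the implicit function theorem within a set, for the fixed point
equation `f (q, φ q) = φ q`. -/
theorem HasFDerivWithinAt.fixedPoint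
    {𝕜 E F : Type*} [NontriviallyNormedField 𝕜] [NormedAddCommGroup E] [NormedSpace 𝕜 E]
    [NormedAddCommGroup F] [NormedSpace 𝕜 F]
    {P : Set E} {V : Set F} {f : E × F → F} {φ : E → F} {p : E} {L : E × F →L[𝕜] F}
    {R : F →L[𝕜] F} (hp : p ∈ P) (hf : HasFDerivWithinAt f L (P ×ˢ V) (p, φ p))
    (hφV : ∀ q ∈ P, φ q ∈ V) (hfix : ∀ q ∈ P, f (q, φ q) = φ q)
    (hφ : ContinuousWithinAt φ P p)
    (hR : R * (1 - L.comp (ContinuousLinearMap.inr 𝕜 E F)) = 1) :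
    HasFDerivWithinAt φ (R.comp (L.comp (ContinuousLinearMap.inl 𝕜 E F))) P p := by
  set l := nhdsWithin p P
  set D := R.comp (L.comp (ContinuousLinearMap.inl 𝕜 E F)) with hD
  have hten : Filter.Tendsto (fun q => (q, φ q)) l (nhdsWithin (p, φ p) (P ×ˢ V)) :=
    tendsto_nhdsWithin_iff.2 ⟨(continuousWithinAt_id.prodMk hφ),
      eventually_nhdsWithin_of_forall fun q hq => ⟨hq, hφV q hq⟩⟩
  have h1 := (hasFDerivWithinAt_iff_isLittleO.1 hf).comp_tendsto hten
  have h2 : (fun q => φ q - φ p - D (q - p)) =o[l]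
      (fun q => (q - p, φ q - φ p)) := by
    refine ((R.isBigO_comp _ l).trans_isLittleO h1).congr' ?_ Filter.EventuallyEq.rfl
    refine eventually_nhdsWithin_of_forall fun q hq => ?_
    have e1 : L (q - p, φ q - φ p) = L (q - p, 0) + L (0, φ q - φ p) := by
      rw [← map_add]; simp
    have e2 := congrArg (fun T : F →L[𝕜] F => T (φ q - φ p)) hR
    simp only [mul_apply_eq_comp, sub_apply,
      one_apply_eq_self, ContinuousLinearMap.comp_apply,
      ContinuousLinearMap.inr_apply] at e2
    simp only [Function.comp_apply, Prod.mk_sub_mk, hfix q hq, hfix p hp, e1, hD,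
      ContinuousLinearMap.comp_apply, ContinuousLinearMap.inl_apply]
    conv_rhs => rw [← e2]
    rw [← map_sub]
    congr 1
    abel
  have h3 : (fun q => (q - p, φ q - φ p)) =O[l] (fun q => q - p) := by
    refine Asymptotics.IsBigO.of_bound (2 * ‖D‖ + 2) ?_
    filter_upwards [h2.def (c := 1 / 2) (by norm_num)] with q hq
    have e1 : ‖φ q - φ p‖ ≤ ‖φ q - φ p - D (q - p)‖ + ‖D (q - p)‖ := by
      simpa using norm_add_le (φ q - φ p - D (q - p)) (D (q - p))
    have e2 := D.le_opNorm (q - p)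
    have e3 : ‖(q - p, φ q - φ p)‖ ≤ ‖q - p‖ + ‖φ q - φ p‖ := by
      rw [Prod.norm_def]
      exact max_le_add_of_nonneg (norm_nonneg _) (norm_nonneg _)
    linarith
  exact hasFDerivWithinAt_iff_isLittleO.2 (h2.trans_isBigO h3)


/-- Parameter-dependence of fixed points, C¹ case:  let `E` be a real
normed space, `F` a real Banach space, `P ⊆ E` and `V ⊆ F` convex subsets
with non-empty interior, `θ < 1`, and `f : P × V → F` a smooth map such that
each `f p := f (p, ·)` is Lipschitz with constant at most `θ`.  If each `f p`
has a fixed point `φ p ∈ V` and `φ` is continuous, then `φ` is smooth. -/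
theorem contDiffOn_one_fixedPoint_of_continuous
    {E F : Type*} [NormedAddCommGroup E] [NormedSpace ℝ E]
    [NormedAddCommGroup F] [NormedSpace ℝ F] [CompleteSpace F]
    (P : Set E) (hP : Convex ℝ P) (hPint : (interior P).Nonempty)
    (V : Set F) (hV : Convex ℝ V) (hVint : (interior V).Nonempty)
    (θ : ℝ) (hθ : θ < 1)
    (f : E × F → F) (hf : ContDiffOn ℝ 1 f (P ×ˢ V))
    (hlip : ∀ p ∈ P, ∀ x ∈ V, ∀ y ∈ V, ‖f (p, y) - f (p, x)‖ ≤ θ * ‖y - x‖)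
    (φ : E → F) (hφV : ∀ p ∈ P, φ p ∈ V)
    (hfix : ∀ p ∈ P, f (p, φ p) = φ p)
    (hφcont : ContinuousOn φ P) :
    ContDiffOn ℝ 1 φ P := by
  have hPu : UniqueDiffOn ℝ P := uniqueDiffOn_convex hP hPint
  have hPVu : UniqueDiffOn ℝ (P ×ˢ V) := hPu.prod (uniqueDiffOn_convex hV hVint)
  have hd := hf.differentiableOn one_ne_zero
  have hc := hf.continuousOn_fderivWithin hPVu le_rfl
  set A : E → E →L[ℝ] F := fun p =>
    (fderivWithin ℝ f (P ×ˢ V) (p, φ p)).comp (ContinuousLinearMap.inl ℝ E F)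
  set B : E → F →L[ℝ] F := fun p =>
    (fderivWithin ℝ f (P ×ˢ V) (p, φ p)).comp (ContinuousLinearMap.inr ℝ E F)
  have hmaps : Set.MapsTo (fun p => (p, φ p)) P (P ×ˢ V) := fun p hp => ⟨hp, hφV p hp⟩
  have hLc : ContinuousOn (fun p => fderivWithin ℝ f (P ×ˢ V) (p, φ p)) P :=
    hc.comp (continuousOn_id.prodMk hφcont) hmaps
  have hBlt : ∀ p ∈ P, ‖B p‖ < 1 := fun p hp =>
    (norm_fderivWithin_comp_inr_le hV hVint (le_max_right θ 0) hd hc hp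
      (fun x hx y hy => (hlip p hp x hx y hy).trans
        (mul_le_mul_of_nonneg_right (le_max_left θ 0) (norm_nonneg _)))
      (hφV p hp)).trans_lt (max_lt hθ one_pos)
  have hunit : ∀ p ∈ P, IsUnit (1 - B p) := fun p hp => (Units.oneSub (B p) (hBlt p hp)).isUnit
  have hder : ∀ p ∈ P, HasFDerivWithinAt φ ((Ring.inverse (1 - B p)).comp (A p)) P p :=
    fun p hp => HasFDerivWithinAt.fixedPoint hp (hd _ (hmaps hp)).hasFDerivWithinAt hφV hfix
      (hφcont p hp) (Ring.inverse_mul_cancel _ (hunit p hp))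
  refine contDiffOn_succ_of_fderivWithin (n := 0)
    (fun p hp => (hder p hp).differentiableWithinAt) (by simp) (contDiffOn_zero.2 ?_)
  have hinv : ContinuousOn (fun p => Ring.inverse (1 - B p)) P := by
    intro p hp
    have hat : ContinuousAt Ring.inverse (1 - B p) := by
      obtain ⟨u, hu⟩ := hunit p hp
      rw [← hu]
      exact NormedRing.inverse_continuousAt u
    exact ContinuousAt.comp_continuousWithinAt (f := fun p => 1 - B p) hat
      ((continuousOn_const.sub (hLc.clm_comp continuousOn_const)) p hp)
  exact (hinv.clm_comp (hLc.clm_comp continuousOn_const)).congr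
    fun p hp => (hder p hp).fderivWithin (hPu p hp)
end

section
/- Let K ⊆ ℝⁿ be a compact convex set with non-empty interior and γ : K → ℝⁿ be a smooth map (infinitely differentiable on K in the sense of ContDiffOn) such that: γ vanishes on the frontier of K; the map φ := id + γ is injective on K; for every x ∈ K the linear map id + γ'(x) : ℝⁿ → ℝⁿ is bijective, where γ'(x) denotes the derivative of γ within K at x; and there exists x₀ in the interior of K with x₀ + γ(x₀) in the interior of K. Then φ maps K bijectively onto K, φ maps the interior of K onto the interior of K, φ fixes every point of the frontier of K, and φ : K → K is a homeomorphism. -/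
open Set in
/-- A continuous map on a compact set with connected interior which is injective, fixes the frontier
pointwise, is open on the interior and sends some interior point into the interior maps the interior
onto itself. -/
theorem image_interior_eq_of_injOn_of_fix_frontier {X : Type*} [TopologicalSpace X] [T2Space X]
    {K : Set X} {f : X → X} (hK : IsCompact K) (hconn : IsPreconnected (interior K))
    (hf : ContinuousOn f K) (hinj : InjOn f K) (hfix : ∀ x ∈ frontier K, f x = x)
    (hopen : IsOpen (f '' interior K)) (hne : ∃ x ∈ interior K, f x ∈ interior K) :
    f '' interior K = interior K := by
  obtain ⟨x₀, hx₀, hfx₀⟩ := hne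
  have hdisj : ∀ x ∈ interior K, f x ∉ frontier K := fun x hx hfr => by
    have := hinj (interior_subset hx) (hK.isClosed.frontier_subset hfr) (hfix _ hfr).symm
    exact hfr.2 (this ▸ hx)
  apply Subset.antisymm
  · refine (hconn.image f (hf.mono interior_subset)).subset_left_of_subset_union
      isOpen_interior hK.isClosed.isOpen_compl
      (disjoint_compl_right.mono_left interior_subset) ?_ ⟨f x₀, ⟨x₀, hx₀, rfl⟩, hfx₀⟩
    rintro _ ⟨x, hx, rfl⟩
    by_contra! h
    simp only [mem_union, mem_compl_iff, not_or, not_not] at h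
    exact hdisj x hx ⟨subset_closure h.2, h.1⟩
  · refine hconn.subset_left_of_subset_union hopen (hK.image_of_continuousOn hf).isClosed.isOpen_compl
      (disjoint_compl_right.mono_left (image_mono interior_subset)) ?_ ⟨f x₀, hfx₀, ⟨x₀, hx₀, rfl⟩⟩
    intro y hy
    by_contra! h
    simp only [mem_union, mem_compl_iff, not_or, not_not] at h
    obtain ⟨h, x, hx, rfl⟩ := h
    have hxf : x ∈ frontier K := ⟨subset_closure hx, fun hxi => h ⟨x, hxi, rfl⟩⟩
    exact hxf.2 (hfix x hxf ▸ hy)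


/-- Let `K ⊆ ℝⁿ` be a compact convex set with non-empty interior and
`γ : K → ℝⁿ` a smooth map vanishing on the frontier of `K`, such that
`φ := id + γ` is injective on `K`, the linear map `id + γ'(x)` is bijective
for every `x ∈ K`, and `x₀ + γ x₀` lies in the interior of `K` for some
`x₀ ∈ interior K`.  Then `φ` maps `K` bijectively onto `K`, maps the interior
of `K` onto the interior of `K`, fixes the frontier of `K` pointwise, and
`φ : K → K` is a homeomorphism. -/
theorem bijOn_and_homeomorph_of_contDiffOn_perturbation_of_id
    {n : ℕ} (K : Set (EuclideanSpace ℝ (Fin n)))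
    (hK : IsCompact K) (hKconv : Convex ℝ K) (hKint : (interior K).Nonempty)
    (γ : EuclideanSpace ℝ (Fin n) → EuclideanSpace ℝ (Fin n))
    (hγ : ContDiffOn ℝ (⊤ : ℕ∞) γ K)
    (hγbd : ∀ x ∈ frontier K, γ x = 0)
    (hinj : Set.InjOn (fun x => x + γ x) K)
    (hderiv : ∀ x ∈ K,
      Function.Bijective (fun v => v + fderivWithin ℝ γ K x v))
    (hx₀ : ∃ x₀ ∈ interior K, x₀ + γ x₀ ∈ interior K) :
    Set.BijOn (fun x => x + γ x) K K ∧
    (fun x => x + γ x) '' interior K = interior K ∧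
    (∀ x ∈ frontier K, x + γ x = x) ∧
    ∃ h : K ≃ₜ K, ∀ x : K, (h x : EuclideanSpace ℝ (Fin n)) = x + γ x := by
  have hfix : ∀ x ∈ frontier K, x + γ x = x := fun x hx => by rw [hγbd x hx, add_zero]
  have hcont : ContinuousOn (fun x => x + γ x) K := continuousOn_id.add hγ.continuousOn
  have hopen : IsOpen ((fun x => x + γ x) '' interior K) := by
    rw [isOpen_iff_mem_nhds]
    rintro _ ⟨x, hx, rfl⟩
    have hKx : K ∈ nhds x := mem_interior_iff_mem_nhds.1 hx
    have hstrict := (hasStrictFDerivAt_id (𝕜 := ℝ) x).add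
      ((hγ.contDiffAt hKx).hasStrictFDerivAt (by simp))
    have hsurj := (hderiv x (interior_subset hx)).2
    rw [fderivWithin_of_mem_nhds hKx] at hsurj
    have hmap : Filter.map (fun x => x + γ x) (nhds x) = nhds (x + γ x) :=
      hstrict.map_nhds_eq_of_surj (LinearMap.range_eq_top.2 hsurj)
    exact hmap ▸ Filter.image_mem_map (isOpen_interior.mem_nhds hx)
  have himage := image_interior_eq_of_injOn_of_fix_frontier hK hKconv.interior.isPreconnected
    hcont hinj hfix hopen hx₀
  have hfrontier : ∀ x ∈ K, x ∉ interior K → x + γ x = x := fun x hx hxi =>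
    hfix x ⟨subset_closure hx, hxi⟩
  have hbij : Set.BijOn (fun x => x + γ x) K K := by
    refine ⟨fun x hx => ?_, hinj, fun y hy => ?_⟩
    · by_cases hxi : x ∈ interior K
      · exact interior_subset (himage.subset ⟨x, hxi, rfl⟩)
      · simpa only [hfrontier x hx hxi] using hx
    · by_cases hyi : y ∈ interior K
      · exact Set.image_mono interior_subset (himage.superset hyi)
      · exact ⟨y, hy, hfrontier y hy hyi⟩
  refine ⟨hbij, himage, hfix, ?_⟩
  have : CompactSpace K := isCompact_iff_compactSpace.1 hK
  exact ⟨Continuous.homeoOfEquivCompactToT2 (f := hbij.equiv) (hcont.mapsToRestrict hbij.mapsTo),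
    fun _ => rfl⟩
end

section
/- Let K ⊆ ℝⁿ be a compact convex set with non-empty interior and γ : K → ℝⁿ be a smooth map (infinitely differentiable on K in the sense of ContDiffOn) such that: γ vanishes on the frontier of K; φ := id + γ is injective on K; for every x ∈ K the linear map id + γ'(x) : ℝⁿ → ℝⁿ is bijective, where γ'(x) is the derivative of γ within K at x; and there exists x₀ in the interior of K with x₀ + γ(x₀) in the interior of K. Then φ maps K bijectively onto K and the inverse map φ⁻¹ : K → K is smooth (infinitely differentiable on K in the sense of ContDiffOn). -/
open Set Filter Topology
open scoped ContDiff

/-- An inverse of a continuous map on a compact set is continuous. -/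
theorem IsCompact.continuousOn_image_of_leftInvOn {X Y : Type*} [TopologicalSpace X]
    [TopologicalSpace Y] [T2Space Y] {s : Set X} {f : X → Y} {g : Y → X} (hs : IsCompact s)
    (hf : ContinuousOn f s) (hgf : LeftInvOn g f s) : ContinuousOn g (f '' s) := by
  refine continuousOn_iff_isClosed.2 fun t ht => ⟨f '' (s ∩ t), ?_, ?_⟩
  · exact ((hs.inter_right ht).image_of_continuousOn (hf.mono inter_subset_left)).isClosed
  · ext y
    constructor
    · rintro ⟨hy, x, hx, rfl⟩
      rw [mem_preimage, hgf hx] at hy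
      exact ⟨mem_image_of_mem f ⟨hx, hy⟩, mem_image_of_mem f hx⟩
    · rintro ⟨⟨x, hx, rfl⟩, hy⟩
      refine ⟨?_, hy⟩
      rw [mem_preimage, hgf hx.1]
      exact hx.2

/-- A preconnected set meeting the interior of `s` but not its frontier lies in the interior. -/
theorem IsPreconnected.subset_interior_of_disjoint_frontier {X : Type*} [TopologicalSpace X]
    {s t : Set X} (ht : IsPreconnected t) (hst : (t ∩ interior s).Nonempty)
    (hd : Disjoint t (frontier s)) : t ⊆ interior s := by
  refine ht.subset_of_closure_inter_subset isOpen_interior hst fun x hx => ?_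
  by_contra hxs
  exact hd.notMem_of_mem_left hx.2 ⟨closure_mono interior_subset hx.1, hxs⟩

/-- An injective continuous map on a compact set with connected interior that fixes the frontier,
is open on the interior, and maps some interior point to an interior point, is a bijection of the
set onto itself. -/
theorem IsCompact.bijOn_of_eqOn_frontier {X : Type*} [TopologicalSpace X] [T2Space X]
    {s : Set X} {f : X → X} (hs : IsCompact s) (hconn : IsPreconnected (interior s))
    (hf : ContinuousOn f s) (hinj : InjOn f s) (hfix : EqOn f id (frontier s))
    (hopen : IsOpen (f '' interior s)) (hmeet : ∃ x ∈ interior s, f x ∈ interior s) :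
    BijOn f s s := by
  obtain ⟨x₀, hx₀, hfx₀⟩ := hmeet
  have hfr : frontier s ⊆ s := hs.isClosed.frontier_subset
  have hsplit : s = interior s ∪ frontier s := by
    rw [← closure_eq_interior_union_frontier, hs.isClosed.closure_eq]
  have hdisj : Disjoint (f '' interior s) (frontier s) := by
    rw [disjoint_left]
    rintro _ ⟨x, hx, rfl⟩ hfx
    have h : f x = x := hinj (hfr hfx) (interior_subset hx) (hfix hfx)
    exact (h ▸ hfx).2 hx
  have hsub : f '' interior s ⊆ interior s :=
    (hconn.image f (hf.mono interior_subset)).subset_interior_of_disjoint_frontier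
      ⟨f x₀, mem_image_of_mem f hx₀, hfx₀⟩ hdisj
  have hsup : interior s ⊆ f '' interior s := by
    refine hconn.subset_of_closure_inter_subset hopen
      ⟨f x₀, hfx₀, mem_image_of_mem f hx₀⟩ ?_
    rintro y ⟨hy, hys⟩
    obtain ⟨x, hx, rfl⟩ := closure_minimal (image_mono interior_subset)
      (hs.image_of_continuousOn hf).isClosed hy
    refine mem_image_of_mem f (by_contra fun hxi => ?_)
    have hxf : x ∈ frontier s := ⟨subset_closure hx, hxi⟩
    rw [hfix hxf] at hys
    exact hxi hys
  refine ⟨fun x hx => ?_, hinj, fun y hy => ?_⟩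
  · rw [hsplit] at hx
    rcases hx with hx | hx
    · exact interior_subset (hsub (mem_image_of_mem f hx))
    · exact (hfix hx).symm ▸ hfr hx
  · rw [hsplit] at hy
    rcases hy with hy | hy
    · exact image_mono interior_subset (hsup hy)
    · exact ⟨y, hfr hy, hfix hy⟩

/-- A continuous inverse of a smooth map with invertible derivatives, between sets with unique
derivatives, is smooth. -/
theorem ContDiffOn.infty_of_rightInvOn {𝕜 E F : Type*} [NontriviallyNormedField 𝕜]
    [NormedAddCommGroup E] [NormedSpace 𝕜 E] [CompleteSpace E]
    [NormedAddCommGroup F] [NormedSpace 𝕜 F]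
    {f : E → F} {g : F → E} {s : Set E} {t : Set F} (hf : ContDiffOn 𝕜 ∞ f s)
    (hs : UniqueDiffOn 𝕜 s) (ht : UniqueDiffOn 𝕜 t) (hg : ContinuousOn g t) (hgt : MapsTo g t s)
    (hfg : RightInvOn g f t) (hinv : ∀ x ∈ s, (fderivWithin 𝕜 f s x).IsInvertible) :
    ContDiffOn 𝕜 ∞ g t := by
  have hderiv : ∀ y ∈ t, HasFDerivWithinAt g (fderivWithin 𝕜 f s (g y)).inverse t y := by
    intro y hy
    obtain ⟨e, he⟩ := hinv _ (hgt hy)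
    rw [← he, ContinuousLinearMap.inverse_equiv]
    refine HasFDerivWithinAt.of_local_left_inverse
      ((hg y hy).tendsto_nhdsWithin hgt) ?_ hy (eventually_mem_nhdsWithin.mono hfg)
    rw [he]
    exact (hf.differentiableOn (by simp) _ (hgt hy)).hasFDerivWithinAt
  rw [contDiffOn_infty]
  intro n
  induction n with
  | zero => exact contDiffOn_zero.2 hg
  | succ n ih =>
    push_cast
    refine (contDiffOn_succ_iff_hasFDerivWithinAt_of_uniqueDiffOn ht).2
      ⟨by simp, _, fun y hy => ?_, hderiv⟩
    have hf' : ContDiffOn 𝕜 n (fderivWithin 𝕜 f s) s := by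
      refine hf.fderivWithin hs ?_
      exact_mod_cast (le_top : ((n + 1 : ℕ) : ℕ∞) ≤ ⊤)
    obtain ⟨e, he⟩ := hinv _ (hgt hy)
    have hi : ContDiffAt 𝕜 n ContinuousLinearMap.inverse (fderivWithin 𝕜 f s (g y)) :=
      he ▸ contDiffAt_map_inverse e
    exact hi.comp_contDiffWithinAt y (hf'.comp ih hgt y hy)

/-- Let `K ⊆ ℝⁿ` be a compact convex set with non-empty interior and
`γ : K → ℝⁿ` a smooth map vanishing on the frontier of `K`, such that
`φ := id + γ` is injective on `K`, the linear map `id + γ'(x)` is bijective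
for every `x ∈ K`, and `x₀ + γ x₀` lies in the interior of `K` for some
`x₀ ∈ interior K`.  Then `φ` maps `K` bijectively onto `K` and the inverse
map `φ⁻¹ : K → K` is smooth on `K`. -/
theorem bijOn_and_contDiffOn_inverse_of_contDiffOn_perturbation_of_id
    {n : ℕ} (K : Set (EuclideanSpace ℝ (Fin n)))
    (hK : IsCompact K) (hKconv : Convex ℝ K) (hKint : (interior K).Nonempty)
    (γ : EuclideanSpace ℝ (Fin n) → EuclideanSpace ℝ (Fin n))
    (hγ : ContDiffOn ℝ (⊤ : ℕ∞) γ K)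
    (hγbd : ∀ x ∈ frontier K, γ x = 0)
    (hinj : Set.InjOn (fun x => x + γ x) K)
    (hderiv : ∀ x ∈ K,
      Function.Bijective (fun v => v + fderivWithin ℝ γ K x v))
    (hx₀ : ∃ x₀ ∈ interior K, x₀ + γ x₀ ∈ interior K) :
    Set.BijOn (fun x => x + γ x) K K ∧
    ∃ ψ : EuclideanSpace ℝ (Fin n) → EuclideanSpace ℝ (Fin n),
      Set.MapsTo ψ K K ∧
      (∀ x ∈ K, ψ (x + γ x) = x) ∧
      (∀ x ∈ K, ψ x + γ (ψ x) = x) ∧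
      ContDiffOn ℝ (⊤ : ℕ∞) ψ K := by
  set f : EuclideanSpace ℝ (Fin n) → EuclideanSpace ℝ (Fin n) := fun x => x + γ x with hf_def
  have hud : UniqueDiffOn ℝ K := uniqueDiffOn_convex hKconv hKint
  have hf : ContDiffOn ℝ ∞ f K := contDiffOn_id.add hγ
  have hf' : ∀ x ∈ K, (fderivWithin ℝ f K x).IsInvertible := by
    intro x hx
    have h : fderivWithin ℝ f K x = ContinuousLinearMap.id ℝ _ + fderivWithin ℝ γ K x :=
      ((hasFDerivWithinAt_id x K).add
        (hγ.differentiableOn (by simp) x hx).hasFDerivWithinAt).fderivWithin (hud x hx)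
    have hb : Function.Bijective (fderivWithin ℝ f K x) := by
      rw [h]
      exact hderiv x hx
    exact ⟨ContinuousLinearEquiv.ofBijective _ (LinearMap.ker_eq_bot.2 hb.1)
      (LinearMap.range_eq_top.2 hb.2), ContinuousLinearEquiv.coe_ofBijective _ _ _⟩
  have hopen : IsOpen (f '' interior K) := by
    rw [isOpen_iff_mem_nhds]
    rintro _ ⟨x, hx, rfl⟩
    have hKx : K ∈ 𝓝 x := mem_interior_iff_mem_nhds.1 hx
    obtain ⟨e, he⟩ := hf' x (interior_subset hx)
    have hstrict : HasStrictFDerivAt f (e : _ →L[ℝ] _) x := by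
      rw [he, fderivWithin_of_mem_nhds hKx]
      exact (hf.contDiffAt hKx).hasStrictFDerivAt (by simp)
    rw [← hstrict.map_nhds_eq_of_equiv]
    exact image_mem_map (isOpen_interior.mem_nhds hx)
  have hbij : BijOn f K K := hK.bijOn_of_eqOn_frontier hKconv.interior.isPreconnected
    hf.continuousOn hinj (fun x hx => by simp [hf_def, hγbd x hx]) hopen hx₀
  have hinv := hbij.invOn_invFunOn
  have hmaps : MapsTo (Function.invFunOn f K) K K := hbij.surjOn.mapsTo_invFunOn
  refine ⟨hbij, Function.invFunOn f K, hmaps, hinv.1, hinv.2, ?_⟩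
  refine hf.infty_of_rightInvOn hud hud ?_ hmaps hinv.2 hf'
  simpa only [hbij.image_eq] using hK.continuousOn_image_of_leftInvOn hf.continuousOn hinv.1
end

section
/- Let F be a real Banach space, U ⊆ F a convex subset with non-empty interior, K ⊆ ℝⁿ a compact convex set with non-empty interior, and f : U × K → K a smooth map (infinitely differentiable on U × K in the sense of ContDiffOn) such that for every z ∈ U the map f_z := f(z, ·) : K → K is a bijection of K which fixes every point of the frontier of K and whose inverse (f_z)⁻¹ : K → K is smooth on K. Then the map g : U × K → K, g(z, y) := (f_z)⁻¹(y), is smooth on U × K. -/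
open Set Filter Topology
open scoped ContDiff

/-- A family of right inverses with values in a compact set of a jointly continuous family of
injective maps is jointly continuous. -/
theorem continuousOn_of_fiberwise_inverse {X Y Z : Type*} [TopologicalSpace X]
    [TopologicalSpace Y] [TopologicalSpace Z] [T2Space Z] {U : Set X} {K : Set Y} {L : Set Z}
    (hK : IsCompact K) {f : X × Y → Z} {g : X × Z → Y} (hf : ContinuousOn f (U ×ˢ K))
    (hinj : ∀ z ∈ U, InjOn (fun x => f (z, x)) K)
    (hgK : ∀ z ∈ U, MapsTo (fun y => g (z, y)) L K)
    (hfg : ∀ z ∈ U, ∀ y ∈ L, f (z, g (z, y)) = y) :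
    ContinuousOn g (U ×ˢ L) := by
  rintro ⟨z, y⟩ ⟨hz, hy⟩
  have hmem : ∀ᶠ p in 𝓝[U ×ˢ L] (z, y), p ∈ U ×ˢ L := self_mem_nhdsWithin
  refine hK.tendsto_nhds_of_unique_mapClusterPt (hmem.mono fun p hp => hgK p.1 hp.1 hp.2)
    fun x hx hcl => ?_
  obtain ⟨𝒰, h𝒰, hlim⟩ := mapClusterPt_iff_ultrafilter.1 hcl
  have hid : Tendsto id (𝒰 : Filter (X × Z)) (𝓝 (z, y)) := h𝒰.trans nhdsWithin_le_nhds
  have hmem' : ∀ᶠ p in (𝒰 : Filter (X × Z)), p ∈ U ×ˢ L := h𝒰 hmem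
  have hpair : Tendsto (fun p => (p.1, g p)) (𝒰 : Filter (X × Z)) (𝓝[U ×ˢ K] (z, x)) :=
    tendsto_nhdsWithin_iff.2 ⟨hid.fst_nhds.prodMk_nhds hlim,
      hmem'.mono fun p hp => ⟨hp.1, hgK p.1 hp.1 hp.2⟩⟩
  have hfx : Tendsto (fun p => f (p.1, g p)) (𝒰 : Filter (X × Z)) (𝓝 (f (z, x))) :=
    (hf (z, x) ⟨hz, hx⟩).tendsto.comp hpair
  have hfy : Tendsto (fun p => f (p.1, g p)) (𝒰 : Filter (X × Z)) (𝓝 y) :=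
    hid.snd_nhds.congr' (hmem'.mono fun p hp => (hfg p.1 hp.1 p.2 hp.2).symm)
  refine hinj z hz hx (hgK z hz hy) ?_
  exact (tendsto_nhds_unique hfx hfy).trans (hfg z hz y hy).symm

/-- A continuous right inverse of a smooth map whose derivative is invertible is smooth, on sets
with unique derivatives. -/
theorem ContDiffOn.of_rightInverse {𝕜 E G : Type*} [NontriviallyNormedField 𝕜]
    [NormedAddCommGroup E] [NormedSpace 𝕜 E] [CompleteSpace E] [NormedAddCommGroup G]
    [NormedSpace 𝕜 G] {s : Set E} {t : Set G} {φ : E → G} {ψ : G → E}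
    (hs : UniqueDiffOn 𝕜 s) (ht : UniqueDiffOn 𝕜 t) (hφ : ContDiffOn 𝕜 ∞ φ s)
    (hψ : ContinuousOn ψ t) (hmaps : MapsTo ψ t s) (hinv : ∀ y ∈ t, φ (ψ y) = y)
    (hderiv : ∀ y ∈ t, (fderivWithin 𝕜 φ s (ψ y)).IsInvertible) :
    ContDiffOn 𝕜 ∞ ψ t := by
  have hψ' : ∀ y ∈ t, HasFDerivWithinAt ψ (fderivWithin 𝕜 φ s (ψ y)).inverse t y := by
    intro y hy
    obtain ⟨e, he⟩ := hderiv y hy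
    rw [← he, ContinuousLinearMap.inverse_equiv]
    refine HasFDerivWithinAt.of_local_left_inverse (t := s)
      ((hψ y hy).tendsto_nhdsWithin hmaps) ?_ hy (eventually_nhdsWithin_of_forall hinv)
    rw [he]
    exact (hφ.differentiableOn (by simp) _ (hmaps hy)).hasFDerivWithinAt
  have hφ' : ContDiffOn 𝕜 ∞ (fderivWithin 𝕜 φ s) s :=
    ((contDiffOn_infty_iff_fderivWithin hs).1 hφ).2
  refine contDiffOn_infty.2 fun k => ?_
  induction k with
  | zero => exact contDiffOn_zero.2 hψ
  | succ k ih =>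
    refine (contDiffOn_succ_iff_fderivWithin ht).2
      ⟨fun y hy => (hψ' y hy).differentiableWithinAt, fun h => absurd h (WithTop.natCast_ne_top k), ?_⟩
    have hcomp : ContDiffOn 𝕜 k (fun y => (fderivWithin 𝕜 φ s (ψ y)).inverse) t := by
      intro y hy
      exact (hderiv y hy).contDiffAt_map_inverse.comp_contDiffWithinAt y
        ((hφ'.of_le (mod_cast le_top)).comp ih hmaps y hy)
    exact hcomp.congr fun y hy => (hψ' y hy).fderivWithin (ht y hy)

/-- Derivatives of mutually inverse maps are mutually inverse. -/
theorem HasFDerivWithinAt.comp_eq_id_of_leftInvOn {𝕜 E G : Type*} [NontriviallyNormedField 𝕜]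
    [NormedAddCommGroup E] [NormedSpace 𝕜 E] [NormedAddCommGroup G] [NormedSpace 𝕜 G]
    {s : Set E} {t : Set G} {φ : E → G} {ψ : G → E} {φ' : E →L[𝕜] G} {ψ' : G →L[𝕜] E} {x : E}
    (hφ : HasFDerivWithinAt φ φ' s x) (hψ : HasFDerivWithinAt ψ ψ' t (φ x))
    (hs : UniqueDiffOn 𝕜 s) (hmaps : MapsTo φ s t) (hinv : LeftInvOn ψ φ s) (hx : x ∈ s) :
    ψ'.comp φ' = ContinuousLinearMap.id 𝕜 E :=
  hs.eq hx (hψ.comp x hφ hmaps) ((hasFDerivWithinAt_id x s).congr (fun _ hy => hinv hy) (hinv hx))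


/-- Inverse function theorem with parameters (Theorem C):  let `F` be a real
Banach space, `U ⊆ F` a convex subset with non-empty interior, `K ⊆ ℝⁿ` a
compact convex set with non-empty interior, and `f : U × K → K` a smooth map
such that `f z := f (z, ·) : K → K` is a bijection of `K` fixing the frontier
of `K` pointwise, with smooth inverse `g (z, ·) = (f z)⁻¹`, for each `z ∈ U`.
Then the map `g : U × K → K`, `g (z, y) = (f z)⁻¹ y` is smooth on `U × K`. -/
theorem contDiffOn_parameter_dependent_inverse
    {F : Type*} [NormedAddCommGroup F] [NormedSpace ℝ F] [CompleteSpace F]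
    {n : ℕ} (U : Set F) (hU : Convex ℝ U) (hUint : (interior U).Nonempty)
    (K : Set (EuclideanSpace ℝ (Fin n)))
    (hK : IsCompact K) (hKconv : Convex ℝ K) (hKint : (interior K).Nonempty)
    (f g : F × EuclideanSpace ℝ (Fin n) → EuclideanSpace ℝ (Fin n))
    (hf : ContDiffOn ℝ (⊤ : ℕ∞) f (U ×ˢ K))
    (hfbij : ∀ z ∈ U, Set.BijOn (fun y => f (z, y)) K K)
    (hfbd : ∀ z ∈ U, ∀ x ∈ frontier K, f (z, x) = x)
    (hgK : ∀ z ∈ U, Set.MapsTo (fun y => g (z, y)) K K)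
    (hginv : ∀ z ∈ U, ∀ y ∈ K, f (z, g (z, y)) = y ∧ g (z, f (z, y)) = y)
    (hgz : ∀ z ∈ U, ContDiffOn ℝ (⊤ : ℕ∞) (fun y => g (z, y)) K) :
    ContDiffOn ℝ (⊤ : ℕ∞) g (U ×ˢ K) := by
  have hUd := uniqueDiffOn_convex hU hUint
  have hKd := uniqueDiffOn_convex hKconv hKint
  have hUKd := hUd.prod hKd
  have hgcont : ContinuousOn g (U ×ˢ K) :=
    continuousOn_of_fiberwise_inverse hK hf.continuousOn (fun z hz => (hfbij z hz).injOn) hgK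
      fun z hz y hy => (hginv z hz y hy).1
  have hΦ : ContDiffOn ℝ ∞ (fun p => (p.1, f p)) (U ×ˢ K) := contDiffOn_fst.prodMk hf
  refine ContDiffOn.snd (f := fun p => (p.1, g p)) ?_
  refine ContDiffOn.of_rightInverse hUKd hUKd hΦ (continuousOn_fst.prodMk hgcont)
    (fun p hp => ⟨hp.1, hgK p.1 hp.1 hp.2⟩)
    (fun p hp => Prod.ext rfl (hginv p.1 hp.1 p.2 hp.2).1) ?_
  rintro ⟨z, y⟩ ⟨hz, hy⟩
  have hx : g (z, y) ∈ K := hgK z hz hy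
  have hfx : f (z, g (z, y)) = y := (hginv z hz y hy).1
  have hf' := (hf.differentiableOn (by simp) (z, g (z, y)) ⟨hz, hx⟩).hasFDerivWithinAt
  set D := fderivWithin ℝ f (U ×ˢ K) (z, g (z, y))
  set A := D.comp (ContinuousLinearMap.inl ℝ F (EuclideanSpace ℝ (Fin n)))
  set B := D.comp (ContinuousLinearMap.inr ℝ F (EuclideanSpace ℝ (Fin n)))
  have hfz' : HasFDerivWithinAt (fun x => f (z, x)) B K (g (z, y)) :=
    hf'.comp (g (z, y)) (hasFDerivAt_prodMk_right z _).hasFDerivWithinAt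
      fun x hx => ⟨hz, hx⟩
  have hgz' := ((hgz z hz).differentiableOn (by simp) y hy).hasFDerivWithinAt
  set C := fderivWithin ℝ (fun y => g (z, y)) K y
  have hCB : C.comp B = ContinuousLinearMap.id ℝ _ :=
    hfz'.comp_eq_id_of_leftInvOn (ψ := fun y => g (z, y)) (by simpa only [hfx] using hgz') hKd
      (hfbij z hz).mapsTo (fun x hx => (hginv z hz x hx).2) hx
  have hBC : B.comp C = ContinuousLinearMap.id ℝ _ :=
    hgz'.comp_eq_id_of_leftInvOn hfz' hKd (hgK z hz) (fun y hy => (hginv z hz y hy).1) hy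
  have hD : HasFDerivWithinAt (fun p => (p.1, f p))
      ((ContinuousLinearMap.fst ℝ F (EuclideanSpace ℝ (Fin n))).prod D) (U ×ˢ K)
      (z, g (z, y)) := hasFDerivWithinAt_fst.prodMk hf'
  rw [hD.fderivWithin (hUKd _ ⟨hz, hx⟩)]
  refine ⟨(ContinuousLinearEquiv.refl ℝ F).skewProd
    (ContinuousLinearEquiv.equivOfInverse' B C hBC hCB) A,
    ContinuousLinearMap.ext fun v => Prod.ext rfl ?_⟩
  change D (0, v.2) + D (v.1, 0) = D v
  rw [← map_add]
  simp
end

section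
/- Let J ⊆ ℝ be a non-degenerate interval, K ⊆ ℝⁿ a compact convex set with non-empty interior, F a real Banach space, P ⊆ F a convex subset with non-empty interior, and f : P × J × K → ℝⁿ a smooth map (infinitely differentiable on P × J × K in the sense of ContDiffOn) such that f(p, t, x) = 0 for all p ∈ P, t ∈ J, and all x in the frontier of K. Then for every p ∈ P, t₀ ∈ J, and x₀ ∈ K, the initial value problem y'(t) = f(p, t, y(t)), y(t₀) = x₀ has a unique solution y_{p,t₀,x₀} : J → K defined on all of J, and the flow map P × J × J × K → K, (p, t₀, t, x₀) ↦ y_{p,t₀,x₀}(t), is smooth. -/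
open Set Filter Topology unitInterval
open scoped NNReal

universe u v

section Superposition

/-- The superposition (Nemytskii) operator `u ↦ g ∘ u` on spaces of continuous maps, with value `0`
when `g ∘ u` fails to be continuous. -/
noncomputable def superposition {X G : Type*} [TopologicalSpace X] [NormedAddCommGroup G]
    (S : Type*) [TopologicalSpace S] (g : X → G) (u : C(S, X)) : C(S, G) :=
  ContinuousMap.mkD (g ∘ u) 0

/-- The continuous maps with values in `C`. -/
def mapsInto {X : Type*} [TopologicalSpace X] (S : Type*) [TopologicalSpace S] (C : Set X) :
    Set C(S, X) := {u | ∀ s, u s ∈ C}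

variable {S : Type*} [TopologicalSpace S]

lemma superposition_apply {X G : Type*} [TopologicalSpace X] [NormedAddCommGroup G]
    {g : X → G} {C : Set X} (hg : ContinuousOn g C) {u : C(S, X)} (hu : u ∈ mapsInto S C) (s : S) :
    superposition S g u s = g (u s) := by
  have : Continuous (g ∘ u) := hg.comp_continuous u.continuous hu
  simp [superposition, ContinuousMap.mkD, this]

lemma convex_mapsInto {X : Type*} [AddCommGroup X] [Module ℝ X] [TopologicalSpace X] {C : Set X}
    [ContinuousAdd X] [ContinuousConstSMul ℝ X] (hC : Convex ℝ C) : Convex ℝ (mapsInto S C) :=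
  fun _ hu _ hv _ _ ha hb hab s => hC (hu s) (hv s) ha hb hab

lemma continuousOn_superposition {X G : Type*} [TopologicalSpace X] [NormedAddCommGroup G]
    {g : X → G} {C : Set X} (hg : ContinuousOn g C) :
    ContinuousOn (superposition S g) (mapsInto S C) := by
  rw [continuousOn_iff_continuous_domRestrict]
  let gC : C(C, G) := ⟨C.domRestrict g, hg.domRestrict⟩
  let j : mapsInto S C → C(S, C) := fun u => ⟨fun s => ⟨u.1 s, u.2 s⟩, by fun_prop⟩
  let ι : C(C, X) := ⟨Subtype.val, continuous_subtype_val⟩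
  have hj : Continuous j := by
    rw [(ι.isInducing_postcomp IsInducing.subtypeVal).continuous_iff]
    exact continuous_subtype_val
  refine ((gC.continuous_postcomp (X := S)).comp hj).congr fun u => ?_
  ext1 s
  exact (superposition_apply hg u.2 s).symm

variable [CompactSpace S]

lemma nonempty_interior_mapsInto {X : Type*} [SeminormedAddCommGroup X] {C : Set X}
    (hC : (interior C).Nonempty) : (interior (mapsInto S C)).Nonempty := by
  obtain ⟨c, hc⟩ := hC
  obtain ⟨ε, hε, hb⟩ := Metric.isOpen_iff.1 isOpen_interior c hc
  refine ⟨ContinuousMap.const S c, mem_interior.2 ⟨Metric.ball _ ε, fun u hu s => ?_,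
    Metric.isOpen_ball, Metric.mem_ball_self hε⟩⟩
  exact interior_subset (hb ((ContinuousMap.dist_apply_le_dist s).trans_lt (Metric.mem_ball.1 hu)))

variable {X : Type*} [NormedAddCommGroup X] [NormedSpace ℝ X] {C : Set X}

lemma uniqueDiffOn_mapsInto (hC : Convex ℝ C) (hCi : (interior C).Nonempty) :
    UniqueDiffOn ℝ (mapsInto S C) :=
  uniqueDiffOn_convex (convex_mapsInto hC) (nonempty_interior_mapsInto hCi)

/-- Pointwise evaluation of a continuous family of linear maps, as a continuous linear map. -/
noncomputable def pointwiseApply (S : Type*) [TopologicalSpace S] [CompactSpace S]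
    (X G : Type*) [NormedAddCommGroup X] [NormedSpace ℝ X] [NormedAddCommGroup G]
    [NormedSpace ℝ G] : C(S, X →L[ℝ] G) →L[ℝ] C(S, X) →L[ℝ] C(S, G) :=
  LinearMap.mkContinuous₂
    (LinearMap.mk₂ ℝ (fun (a : C(S, X →L[ℝ] G)) (u : C(S, X)) =>
        (⟨fun s => a s (u s), by fun_prop⟩ : C(S, G)))
      (fun _ _ _ => by ext; simp) (fun _ _ _ => by ext; simp)
      (fun _ _ _ => by ext; simp) (fun _ _ _ => by ext; simp))
    1 fun a u => by
      rw [one_mul, ContinuousMap.norm_le _ (by positivity)]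
      intro s
      exact ((a s).le_opNorm _).trans (mul_le_mul (a.norm_coe_le_norm s) (u.norm_coe_le_norm s)
        (norm_nonneg (u s)) (norm_nonneg a))

@[simp]
lemma pointwiseApply_apply {G : Type*} [NormedAddCommGroup G] [NormedSpace ℝ G]
    (a : C(S, X →L[ℝ] G)) (u : C(S, X)) (s : S) : pointwiseApply S X G a u s = a s (u s) := rfl

lemma hasFDerivWithinAt_superposition {G : Type*} [NormedAddCommGroup G] [NormedSpace ℝ G]
    (hC : Convex ℝ C) {g : X → G} {g' : X → X →L[ℝ] G}
    (hg : ∀ x ∈ C, HasFDerivWithinAt g (g' x) C x) (hg' : ContinuousOn g' C)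
    {u : C(S, X)} (hu : u ∈ mapsInto S C) :
    HasFDerivWithinAt (superposition S g) (pointwiseApply S X G (superposition S g' u))
      (mapsInto S C) u := by
  have hgc : ContinuousOn g C := fun x hx => (hg x hx).continuousWithinAt
  rw [hasFDerivWithinAt_iff_isLittleO, Asymptotics.isLittleO_iff]
  intro ε hε
  obtain ⟨δ, hδ, H⟩ := Metric.continuousWithinAt_iff.1
    (continuousOn_superposition (S := S) hg' u hu) ε hε
  filter_upwards [self_mem_nhdsWithin, mem_nhdsWithin_of_mem_nhds (Metric.ball_mem_nhds u hδ)]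
    with v hv hvu
  rw [ContinuousMap.norm_le _ (by positivity)]
  intro s
  have hseg : segment ℝ (u s) (v s) ⊆ C := hC.segment_subset (hu s) (hv s)
  have key := (convex_segment (𝕜 := ℝ) (u s) (v s)).norm_image_sub_le_of_norm_hasFDerivWithin_le'
    (f := g) (f' := g') (φ := g' (u s)) (C := ε) (fun x hx => (hg x (hseg hx)).mono hseg) ?_
    (left_mem_segment ℝ _ _) (right_mem_segment ℝ _ _)
  · have := (v - u).norm_coe_le_norm s
    simp only [ContinuousMap.sub_apply, superposition_apply hgc hu, superposition_apply hgc hv,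
      pointwiseApply_apply, superposition_apply hg' hu] at this ⊢
    exact key.trans (by gcongr)
  · rintro _ ⟨a, b, ha, hb, hab, rfl⟩
    have hw : a • u + b • v ∈ mapsInto S C := convex_mapsInto hC hu hv ha hb hab
    have hd : dist (a • u + b • v) u < δ := by
      have : a • u + b • v - u = b • (v - u) := by
        rw [show a = 1 - b by linarith]; module
      rw [dist_eq_norm, this, norm_smul, Real.norm_of_nonneg hb]
      rw [Metric.mem_ball, dist_eq_norm] at hvu
      nlinarith [norm_nonneg (v - u)]
    have := (ContinuousMap.dist_apply_le_dist s).trans (H hw hd).le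
    rw [superposition_apply hg' hw, superposition_apply hg' hu, dist_eq_norm] at this
    exact this

lemma contDiffOn_superposition_aux {X : Type u} [NormedAddCommGroup X] [NormedSpace ℝ X] {C : Set X}
    (hC : Convex ℝ C) (hCi : (interior C).Nonempty) (k : ℕ) :
    ∀ {G : Type u} [NormedAddCommGroup G] [NormedSpace ℝ G] {g : X → G},
      ContDiffOn ℝ k g C → ContDiffOn ℝ k (superposition S g) (mapsInto S C) := by
  induction k with
  | zero =>
    intro G _ _ g hg
    simp only [CharP.cast_eq_zero, contDiffOn_zero] at hg ⊢
    exact continuousOn_superposition hg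
  | succ k ih =>
    intro G _ _ g hg
    have hU := uniqueDiffOn_convex hC hCi
    have hU' := uniqueDiffOn_mapsInto (S := S) hC hCi
    push_cast at hg ⊢
    obtain ⟨hd, -, hg'⟩ := (contDiffOn_succ_iff_fderivWithin hU).1 hg
    have hD := fun u hu => hasFDerivWithinAt_superposition (S := S) (u := u) hC
      (fun x hx => (hd x hx).hasFDerivWithinAt) hg'.continuousOn hu
    refine (contDiffOn_succ_iff_fderivWithin hU').2
      ⟨fun u hu => (hD u hu).differentiableWithinAt, by simp, ?_⟩
    have hp : ContDiff ℝ k (pointwiseApply S X G) := ContinuousLinearMap.contDiff _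
    exact (hp.comp_contDiffOn (ih hg')).congr
      fun u hu => (hD u hu).fderivWithin (hU' u hu)

/-- Superposition by a smooth map is smooth. -/
lemma contDiffOn_superposition {X : Type u} {G : Type v} [NormedAddCommGroup X] [NormedSpace ℝ X]
    {C : Set X} [NormedAddCommGroup G] [NormedSpace ℝ G] (hC : Convex ℝ C)
    (hCi : (interior C).Nonempty) {g : X → G} (hg : ContDiffOn ℝ (⊤ : ℕ∞) g C) :
    ContDiffOn ℝ (⊤ : ℕ∞) (superposition S g) (mapsInto S C) := by
  let eX := (LinearIsometryEquiv.ulift ℝ X : ULift.{v} X ≃ₗᵢ[ℝ] X).toContinuousLinearEquiv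
  let eG := (LinearIsometryEquiv.ulift ℝ G : ULift.{u} G ≃ₗᵢ[ℝ] G).toContinuousLinearEquiv
  have hC' : Convex ℝ (eX ⁻¹' C) := hC.linear_preimage (eX : ULift.{v} X →ₗ[ℝ] X)
  have hCi' : (interior (eX ⁻¹' C)).Nonempty := by
    rw [show interior (eX ⁻¹' C) = eX ⁻¹' interior C from
      (eX.toHomeomorph.preimage_interior C).symm]
    exact hCi.preimage eX.surjective
  rw [contDiffOn_infty]
  intro k
  have h1 : ContDiffOn ℝ k (eG.symm ∘ g ∘ eX) (eX ⁻¹' C) :=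
    eG.symm.contDiff.comp_contDiffOn ((contDiffOn_infty.1 hg k).comp eX.contDiff.contDiffOn
      fun _ h => h)
  have h2 := contDiffOn_superposition_aux (S := S) hC' hCi' k h1
  let uX : C(S, X) →L[ℝ] C(S, ULift.{v} X) :=
    (eX.symm : X →L[ℝ] ULift.{v} X).compLeftContinuous ℝ S
  let dG : C(S, ULift.{u} G) →L[ℝ] C(S, G) :=
    (eG : ULift.{u} G →L[ℝ] G).compLeftContinuous ℝ S
  have hm : MapsTo uX (mapsInto S C) (mapsInto S (eX ⁻¹' C)) := fun u hu s => hu s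
  have h3 := dG.contDiff.comp_contDiffOn (h2.comp uX.contDiff.contDiffOn hm)
  refine h3.congr fun u hu => ?_
  ext1 s
  rw [superposition_apply hg.continuousOn hu]
  exact (congrArg eG (superposition_apply h1.continuousOn (hm hu) s)).symm

end Superposition

section ImplicitFixedPoint

variable {X Z : Type*} [NormedAddCommGroup X] [NormedSpace ℝ X] [NormedAddCommGroup Z]
  [NormedSpace ℝ Z] {Q : Set X} {D : Set Z} {H : X × Z → Z} {y : X → Z}

lemma hasFDerivWithinAt_of_fixedPoint (hy : MapsTo y Q D) (hfix : ∀ q ∈ Q, H (q, y q) = y q)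
    {q₀ : X} (hq₀ : q₀ ∈ Q) (hyc : ContinuousWithinAt y Q q₀) {H' : X × Z →L[ℝ] Z}
    (hH : HasFDerivWithinAt H H' (Q ×ˢ D) (q₀, y q₀))
    (hu : IsUnit (1 - H' ∘L ContinuousLinearMap.inr ℝ X Z)) :
    HasFDerivWithinAt y (Ring.inverse (1 - H' ∘L ContinuousLinearMap.inr ℝ X Z) ∘L
      (H' ∘L ContinuousLinearMap.inl ℝ X Z)) Q q₀ := by
  set B := H' ∘L ContinuousLinearMap.inr ℝ X Z
  set A := H' ∘L ContinuousLinearMap.inl ℝ X Z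
  set T := Ring.inverse (1 - B)
  have hT : ∀ z, T (z - B z) = z := fun z =>
    DFunLike.congr_fun (Ring.inverse_mul_cancel _ hu) z
  have hlim : Tendsto (fun q => (q, y q)) (𝓝[Q] q₀) (𝓝[Q ×ˢ D] (q₀, y q₀)) :=
    tendsto_nhdsWithin_iff.2 ⟨(continuousWithinAt_id.prodMk hyc),
      eventually_nhdsWithin_of_forall fun q hq => ⟨hq, hy hq⟩⟩
  have h1 := (hasFDerivWithinAt_iff_isLittleO.1 hH).comp_tendsto hlim
  have h2 : (fun q => y q - y q₀ - (T ∘L A) (q - q₀)) =o[𝓝[Q] q₀]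
      fun q => (q - q₀, y q - y q₀) := by
    refine ((T.isBigO_comp _ _).trans_isLittleO h1).congr' ?_ (Eventually.of_forall fun q => rfl)
    filter_upwards [self_mem_nhdsWithin] with q hq
    have hsplit : H' (q - q₀, y q - y q₀) = A (q - q₀) + B (y q - y q₀) := by
      simp only [A, B, ContinuousLinearMap.comp_apply, ← map_add]; simp
    simp only [Function.comp_apply, Prod.mk_sub_mk, hfix q hq, hfix q₀ hq₀, hsplit]
    rw [sub_add_eq_sub_sub_swap, map_sub, hT]; rfl
  have h3 : (fun q => y q - y q₀) =O[𝓝[Q] q₀] fun q => q - q₀ := by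
    refine Asymptotics.IsBigO.of_bound (2 * ‖T ∘L A‖ + 1) ?_
    filter_upwards [(Asymptotics.isLittleO_iff.1 h2) (c := 1 / 2) (by norm_num)] with q hq
    have e1 := (T ∘L A).le_opNorm (q - q₀)
    have e2 : ‖(q - q₀, y q - y q₀)‖ ≤ ‖q - q₀‖ + ‖y q - y q₀‖ := by
      rw [Prod.norm_def]
      exact max_le_add_of_nonneg (norm_nonneg _) (norm_nonneg _)
    have e3 := norm_le_norm_add_norm_sub' (y q - y q₀) ((T ∘L A) (q - q₀))
    linarith
  exact hasFDerivWithinAt_iff_isLittleO.2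
    (h2.trans_isBigO ((Asymptotics.isBigO_refl _ _).prod_left h3))

/-- A continuous family of fixed points of a smooth map is smooth when `1` minus the partial
derivative in the fixed point variable is invertible. -/
lemma contDiffOn_of_fixedPoint [CompleteSpace Z] (hQ : UniqueDiffOn ℝ Q) (hD : UniqueDiffOn ℝ D)
    (hH : ContDiffOn ℝ (⊤ : ℕ∞) H (Q ×ˢ D)) (hy : MapsTo y Q D) (hyc : ContinuousOn y Q)
    (hfix : ∀ q ∈ Q, H (q, y q) = y q)
    (hu : ∀ q ∈ Q, IsUnit (1 - fderivWithin ℝ H (Q ×ˢ D) (q, y q) ∘L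
      ContinuousLinearMap.inr ℝ X Z)) :
    ContDiffOn ℝ (⊤ : ℕ∞) y Q := by
  have hder : ∀ q ∈ Q, HasFDerivWithinAt y _ Q q := fun q hq =>
    hasFDerivWithinAt_of_fixedPoint hy hfix hq (hyc q hq)
      ((hH.differentiableOn (by simp) (q, y q) ⟨hq, hy hq⟩).hasFDerivWithinAt) (hu q hq)
  have hH' : ContDiffOn ℝ (⊤ : ℕ∞) (fderivWithin ℝ H (Q ×ˢ D)) (Q ×ˢ D) :=
    hH.fderivWithin (hQ.prod hD) (by simp)
  rw [contDiffOn_infty]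
  intro k
  induction k with
  | zero => simpa using hyc
  | succ k ih =>
    push_cast
    refine (contDiffOn_succ_iff_fderivWithin hQ).2
      ⟨fun q hq => (hder q hq).differentiableWithinAt, by simp, ?_⟩
    have hg : ContDiffOn ℝ k (fun q => fderivWithin ℝ H (Q ×ˢ D) (q, y q)) Q :=
      (contDiffOn_infty.1 hH' k).comp (contDiffOn_id.prodMk ih) fun q hq => ⟨hq, hy hq⟩
    have hB : ContDiffOn ℝ k (fun q => 1 - fderivWithin ℝ H (Q ×ˢ D) (q, y q) ∘L
        ContinuousLinearMap.inr ℝ X Z) Q :=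
      contDiffOn_const.sub (hg.clm_comp contDiffOn_const)
    have hT : ContDiffOn ℝ k (fun q => Ring.inverse (1 - fderivWithin ℝ H (Q ×ˢ D) (q, y q) ∘L
        ContinuousLinearMap.inr ℝ X Z)) Q := fun q hq => by
      obtain ⟨v, hv⟩ := hu q hq
      have := contDiffAt_ringInverse ℝ (n := k) v
      rw [hv] at this
      exact this.comp_contDiffWithinAt q (hB q hq)
    exact (hT.clm_comp (hg.clm_comp contDiffOn_const)).congr
      fun q hq => (hder q hq).fderivWithin (hQ q hq)

end ImplicitFixedPoint

section Volterra

variable {E : Type*} [NormedAddCommGroup E] [NormedSpace ℝ E]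

/-- The integration operator `z ↦ (s ↦ ∫ r in 0..s, z r)` on `C([0, 1], E)`. -/
noncomputable def volterra (E : Type*) [NormedAddCommGroup E] [NormedSpace ℝ E] :
    C(I, E) →L[ℝ] C(I, E) :=
  LinearMap.mkContinuous
    { toFun := fun z => ⟨fun s => ∫ r in (0 : ℝ)..s, IccExtend zero_le_one z r,
        (intervalIntegral.continuous_primitive
          (fun _ _ => (z.continuous.Icc_extend' (h := zero_le_one)).intervalIntegrable _ _) 0).comp
          continuous_subtype_val⟩
      map_add' := fun z w => by
        ext s
        exact intervalIntegral.integral_add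
          ((z.continuous.Icc_extend' (h := zero_le_one)).intervalIntegrable _ _)
          ((w.continuous.Icc_extend' (h := zero_le_one)).intervalIntegrable _ _)
      map_smul' := fun c z => by
        ext s
        exact intervalIntegral.integral_smul c _ }
    1 fun z => by
      rw [one_mul, ContinuousMap.norm_le _ (norm_nonneg _)]
      intro s
      refine (intervalIntegral.norm_integral_le_of_norm_le_const
        (fun r _ => z.norm_coe_le_norm _)).trans ?_
      rw [sub_zero, abs_of_nonneg s.2.1]
      exact mul_le_of_le_one_right (norm_nonneg _) s.2.2

lemma volterra_apply (z : C(I, E)) (s : I) :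
    volterra E z s = ∫ r in (0 : ℝ)..s, IccExtend zero_le_one z r := rfl

lemma hasDerivWithinAt_volterra [CompleteSpace E] (z : C(I, E)) (s : I) :
    HasDerivWithinAt (IccExtend zero_le_one (volterra E z)) (z s) (Icc 0 1) s := by
  have hc := z.continuous.Icc_extend' (h := zero_le_one)
  have := (hc.integral_hasStrictDerivAt (0 : ℝ) s).hasDerivAt.hasDerivWithinAt (s := Icc 0 1)
  rw [IccExtend_val] at this
  refine this.congr_of_mem (fun r hr => ?_) s.2
  rw [IccExtend_of_mem _ _ hr, volterra_apply]

lemma norm_pow_volterra_comp_apply_le {T : C(I, E) →L[ℝ] C(I, E)} {M : ℝ} (hM : 0 ≤ M)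
    (hT : ∀ z s, ‖T z s‖ ≤ M * ‖z s‖) (n : ℕ) (z : C(I, E)) (s : I) :
    ‖((volterra E ∘L T) ^ n) z s‖ ≤ M ^ n * (s : ℝ) ^ n / n.factorial * ‖z‖ := by
  induction n generalizing s with
  | zero => simpa using z.norm_coe_le_norm s
  | succ n ih =>
    rw [pow_succ', mul_apply_eq_comp, ContinuousLinearMap.comp_apply, volterra_apply]
    have hs := s.2.1
    have hint : ∫ r in (0 : ℝ)..s, M * (M ^ n * r ^ n / n.factorial * ‖z‖) =
        M ^ (n + 1) * (s : ℝ) ^ (n + 1) / (n + 1).factorial * ‖z‖ := by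
      have : ∀ r : ℝ, M * (M ^ n * r ^ n / n.factorial * ‖z‖) =
          (M ^ (n + 1) / n.factorial * ‖z‖) * r ^ n := fun r => by ring
      simp only [this, intervalIntegral.integral_const_mul, integral_pow]
      rw [Nat.factorial_succ]
      push_cast
      field_simp
      simp
    rw [← hint]
    refine intervalIntegral.norm_integral_le_of_norm_le hs ?_
      (Continuous.intervalIntegrable (by fun_prop) _ _)
    refine .of_forall fun r hr => ?_
    have hr' : r ∈ Icc (0 : ℝ) 1 := ⟨hr.1.le, hr.2.trans s.2.2⟩
    rw [IccExtend_of_mem _ _ hr']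
    exact (hT _ _).trans (mul_le_mul_of_nonneg_left (ih ⟨r, hr'⟩) hM)

lemma isUnit_one_sub_volterra_comp [CompleteSpace E] {T : C(I, E) →L[ℝ] C(I, E)} {M : ℝ}
    (hT : ∀ z s, ‖T z s‖ ≤ M * ‖z s‖) : IsUnit (1 - volterra E ∘L T) := by
  wlog hM : 0 ≤ M generalizing M
  · refine this (M := 0) (fun z s => (hT z s).trans ?_) le_rfl
    exact mul_le_mul_of_nonneg_right (not_le.1 hM).le (norm_nonneg _)
  obtain ⟨n, hn⟩ := ((FloorSemiring.tendsto_pow_div_factorial_atTop M).eventually_lt_const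
    (show (0 : ℝ) < 1 by norm_num)).exists
  have hlt : ‖(volterra E ∘L T) ^ n‖ < 1 := by
    refine (ContinuousLinearMap.opNorm_le_bound _ (by positivity) fun z => ?_).trans_lt hn
    rw [ContinuousMap.norm_le _ (by positivity)]
    intro s
    refine (norm_pow_volterra_comp_apply_le hM hT n z s).trans ?_
    gcongr
    exact mul_le_of_le_one_right (by positivity) (pow_le_one₀ s.2.1 s.2.2)
  have hu := isUnit_one_sub_of_norm_lt_one (x := (volterra E ∘L T) ^ n) hlt
  rw [← mul_neg_geom_sum] at hu
  refine ((Commute.isUnit_mul_iff ?_).1 hu).1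
  rw [commute_iff_eq, mul_neg_geom_sum, geom_sum_mul_neg]

end Volterra

section InvariantRegion

variable {E : Type*} [NormedAddCommGroup E] {K : Set E} {L : ℝ≥0}

lemma IsPreconnected.inter_frontier_nonempty_of_mem {α : Type*} [TopologicalSpace α] {s t : Set α}
    (hs : IsPreconnected s) {x y : α} (hx : x ∈ s) (hxt : x ∈ t) (hy : y ∈ s) (hyt : y ∉ t) :
    (s ∩ frontier t).Nonempty := by
  by_contra hne
  have hfr : ∀ z ∈ s, z ∉ frontier t := fun z hz hzt => hne ⟨z, hz, hzt⟩
  have hint : ∀ z ∈ s, z ∈ closure t → z ∈ interior t := fun z hz hzt => by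
    by_contra h
    exact hfr z hz ⟨hzt, h⟩
  obtain ⟨z, -, hz1, hz2⟩ := hs (interior t) (closure t)ᶜ isOpen_interior
    isClosed_closure.isOpen_compl
    (fun z hz => or_iff_not_imp_right.2 fun h => hint z hz (not_not.1 h))
    ⟨x, hx, hint x hx (subset_closure hxt)⟩
    ⟨y, hy, fun h => hyt (interior_subset (hint y hy h))⟩
  exact hz2 (interior_subset_closure hz1)

variable [NormedSpace ℝ E]

lemma LipschitzOnWith.lipschitzWith_indicator_of_frontier {G : Type*} [NormedAddCommGroup G]
    {g : E → G} (hg : LipschitzOnWith L g K) (hK : IsClosed K) (h0 : ∀ x ∈ frontier K, g x = 0) :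
    LipschitzWith L (K.indicator g) := by
  have key : ∀ x ∈ K, ∀ z ∉ K, dist (g x) 0 ≤ L * dist x z := fun x hx z hz => by
    obtain ⟨w, hw, hwf⟩ := (convex_segment (𝕜 := ℝ) x z).isPreconnected
      |>.inter_frontier_nonempty_of_mem (left_mem_segment ℝ x z) hx (right_mem_segment ℝ x z) hz
    rw [← h0 w hwf]
    refine (hg.dist_le_mul x hx w (hK.frontier_subset hwf)).trans ?_
    have := dist_add_dist_of_mem_segment hw
    have := dist_nonneg (x := w) (y := z)
    gcongr
    linarith
  refine LipschitzWith.of_dist_le_mul fun x z => ?_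
  by_cases hx : x ∈ K <;> by_cases hz : z ∈ K <;> simp only [hx, hz, indicator_of_mem,
    indicator_of_notMem, not_false_eq_true]
  · exact hg.dist_le_mul x hx z hz
  · exact key x hx z hz
  · rw [dist_comm, dist_comm x]
    exact key z hz x hx
  · rw [dist_self]
    positivity

lemma HasDerivWithinAt.Ici_of_Icc {y : ℝ → E} {y' : E} {a b t : ℝ}
    (h : HasDerivWithinAt y y' (Icc a b) t) (ht : t ∈ Ico a b) :
    HasDerivWithinAt y y' (Ici t) t :=
  h.mono_of_mem_nhdsWithin (Icc_mem_nhdsGE_of_mem ht)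

/-- A vector field vanishing on the frontier of a compact set `K` has integral curves on `[0, 1]`
through every point of `K`, and these stay in `K`. -/
lemma exists_integralCurve_of_frontier [CompleteSpace E] {g : ℝ → E → E} (hK : IsCompact K)
    (hg : ContinuousOn (Function.uncurry g) (Icc 0 1 ×ˢ K))
    (hL : ∀ s ∈ Icc (0 : ℝ) 1, LipschitzOnWith L (g s) K)
    (h0 : ∀ s ∈ Icc (0 : ℝ) 1, ∀ x ∈ frontier K, g s x = 0) {x₀ : E} (hx₀ : x₀ ∈ K) :
    ∃ y : ℝ → E, y 0 = x₀ ∧ ∀ s ∈ Icc (0 : ℝ) 1, y s ∈ K ∧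
      HasDerivWithinAt y (g s (y s)) (Icc 0 1) s := by
  have hLip : ∀ s ∈ Icc (0 : ℝ) 1, LipschitzWith L (K.indicator (g s)) := fun s hs =>
    (hL s hs).lipschitzWith_indicator_of_frontier hK.isClosed (h0 s hs)
  obtain ⟨M, hM⟩ := (isCompact_Icc.prod hK).exists_bound_of_continuousOn hg
  have hPL : IsPicardLindelof (fun s => K.indicator (g s)) (tmin := 0) (tmax := 1)
      ⟨0, left_mem_Icc.2 zero_le_one⟩ x₀ M.toNNReal 0 M.toNNReal L :=
    { lipschitzOnWith := fun s hs => (hLip s hs).lipschitzOnWith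
      continuousOn := fun x _ => by
        by_cases hx : x ∈ K
        · simp only [hx, indicator_of_mem]
          exact hg.comp (f := fun s : ℝ => (s, x)) (by fun_prop) fun s hs => ⟨hs, hx⟩
        · simp only [hx, indicator_of_notMem, not_false_eq_true]
          exact continuousOn_const
      norm_le := fun s hs x _ => by
        by_cases hx : x ∈ K
        · simp only [hx, indicator_of_mem]
          exact (hM (s, x) ⟨hs, hx⟩).trans (Real.le_coe_toNNReal M)
        · simp [hx]
      mul_max_le := by simp }
  obtain ⟨y, hy0, hy⟩ := hPL.exists_eq_forall_mem_Icc_hasDerivWithinAt₀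
  have hyc : ContinuousOn y (Icc 0 1) := fun s hs => (hy s hs).continuousWithinAt
  have hmem : ∀ s ∈ Icc (0 : ℝ) 1, y s ∈ K := fun s hs => by
    by_contra hys
    have hsub : Icc 0 s ⊆ Icc 0 1 := Icc_subset_Icc_right hs.2
    obtain ⟨-, ⟨r, hr, rfl⟩, hrf⟩ := (isPreconnected_Icc.image y (hyc.mono hsub))
      |>.inter_frontier_nonempty_of_mem (mem_image_of_mem y (left_mem_Icc.2 hs.1))
        (by rw [hy0]; exact hx₀) (mem_image_of_mem y (right_mem_Icc.2 hs.1)) hys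
    have hIcc : Icc r s ⊆ Icc 0 1 := Icc_subset_Icc hr.1 hs.2
    have hconst : ∀ t ∈ Icc r s, K.indicator (g t) (y r) = 0 := fun t ht => by
      rw [indicator_of_mem (hK.isClosed.frontier_subset hrf), h0 t (hIcc ht) _ hrf]
    have hd := dist_le_of_trajectories_ODE_of_mem (v := fun t => K.indicator (g t))
      (s := fun _ => univ) (f := y) (g := fun _ => y r) (δ := 0)
      (fun t ht => (hLip t (hIcc (Ico_subset_Icc_self ht))).lipschitzOnWith)
      (hyc.mono hIcc)
      (fun t ht => (hy t (hIcc (Ico_subset_Icc_self ht))).Ici_of_Icc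
        ⟨hr.1.trans ht.1, ht.2.trans_le hs.2⟩)
      (fun _ _ => mem_univ _) continuousOn_const
      (fun t ht => by
        rw [hconst t (Ico_subset_Icc_self ht)]
        exact hasDerivWithinAt_const _ _ _)
      (fun _ _ => mem_univ _) (dist_self _).le s (right_mem_Icc.2 hr.2)
    rw [zero_mul, dist_le_zero] at hd
    exact hys (hd ▸ hK.isClosed.frontier_subset hrf)
  refine ⟨y, hy0, fun s hs => ⟨hmem s hs, ?_⟩⟩
  have := hy s hs
  rwa [indicator_of_mem (hmem s hs)] at this

lemma dist_integralCurves_le {g₁ g₂ : ℝ → E → E} {ε : ℝ} {y₁ y₂ : ℝ → E}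
    (hL : ∀ s ∈ Icc (0 : ℝ) 1, LipschitzOnWith L (g₂ s) K)
    (hε : ∀ s ∈ Icc (0 : ℝ) 1, ∀ x ∈ K, dist (g₁ s x) (g₂ s x) ≤ ε)
    (h₁ : ∀ s ∈ Icc (0 : ℝ) 1, y₁ s ∈ K ∧ HasDerivWithinAt y₁ (g₁ s (y₁ s)) (Icc 0 1) s)
    (h₂ : ∀ s ∈ Icc (0 : ℝ) 1, y₂ s ∈ K ∧ HasDerivWithinAt y₂ (g₂ s (y₂ s)) (Icc 0 1) s)
    {s : ℝ} (hs : s ∈ Icc (0 : ℝ) 1) :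
    dist (y₁ s) (y₂ s) ≤ gronwallBound (dist (y₁ 0) (y₂ 0)) L ε 1 := by
  have h0 : (0 : ℝ) ∈ Icc (0 : ℝ) 1 := left_mem_Icc.2 zero_le_one
  have hIco : ∀ {t : ℝ}, t ∈ Ico (0 : ℝ) 1 → t ∈ Icc (0 : ℝ) 1 := fun h => Ico_subset_Icc_self h
  have := dist_le_of_approx_trajectories_ODE_of_mem (v := g₂) (s := fun _ => K) (εg := 0)
    (fun t ht => hL t (hIco ht))
    (fun t ht => (h₁ t ht).2.continuousWithinAt) (fun t ht => (h₁ t (hIco ht)).2.Ici_of_Icc ht)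
    (fun t ht => hε t (hIco ht) _ (h₁ t (hIco ht)).1) (fun t ht => (h₁ t (hIco ht)).1)
    (fun t ht => (h₂ t ht).2.continuousWithinAt) (fun t ht => (h₂ t (hIco ht)).2.Ici_of_Icc ht)
    (fun t ht => (dist_self _).le) (fun t ht => (h₂ t (hIco ht)).1) le_rfl s hs
  rw [add_zero, sub_zero] at this
  exact this.trans (gronwallBound_mono dist_nonneg
    (dist_nonneg.trans (hε 0 h0 _ (h₁ 0 h0).1)) L.2 hs.2)

lemma eqOn_integralCurves {g : ℝ → E → E} {y₁ y₂ : ℝ → E}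
    (hL : ∀ s ∈ Icc (0 : ℝ) 1, LipschitzOnWith L (g s) K)
    (h₁ : ∀ s ∈ Icc (0 : ℝ) 1, y₁ s ∈ K ∧ HasDerivWithinAt y₁ (g s (y₁ s)) (Icc 0 1) s)
    (h₂ : ∀ s ∈ Icc (0 : ℝ) 1, y₂ s ∈ K ∧ HasDerivWithinAt y₂ (g s (y₂ s)) (Icc 0 1) s)
    (h : y₁ 0 = y₂ 0) : EqOn y₁ y₂ (Icc 0 1) := fun s hs => by
  have := dist_integralCurves_le hL (fun _ _ _ _ => (dist_self _).le) h₁ h₂ hs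
  rwa [h, dist_self, gronwallBound_ε0_δ0, dist_le_zero] at this

lemma tendsto_gronwallBound_zero (L x : ℝ) :
    Tendsto (fun p : ℝ × ℝ => gronwallBound p.1 L p.2 x) (𝓝 (0, 0)) (𝓝 0) := by
  have hc : Continuous fun p : ℝ × ℝ => gronwallBound p.1 L p.2 x := by
    by_cases hL : L = 0
    · simp only [hL, gronwallBound_K0]
      fun_prop
    · simp only [gronwallBound_of_K_ne_0 hL]
      fun_prop
  simpa [gronwallBound_ε0_δ0] using hc.tendsto (0, 0)

end InvariantRegion

section Flow

variable {F E : Type*} [NormedAddCommGroup F] [NormedAddCommGroup E] [NormedSpace ℝ E]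

/-- The vector field `f (p, ·, ·)` after the affine change of time that maps `[0, 1]` onto the
interval from `t₀` to `t`, where `q = (p, t₀, t, x₀)`. -/
def rescaledField (f : F × ℝ × E → E) (q : F × ℝ × ℝ × E) (s : ℝ) (x : E) : E :=
  (q.2.2.1 - q.2.1) • f (q.1, q.2.1 + s * (q.2.2.1 - q.2.1), x)

variable {P : Set F} {J : Set ℝ} {K : Set E} {f : F × ℝ × E → E} {q : F × ℝ × ℝ × E}

lemma rescaledTime_mem (hJ : Convex ℝ J) {t₀ t s : ℝ} (ht₀ : t₀ ∈ J) (ht : t ∈ J)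
    (hs : s ∈ Icc (0 : ℝ) 1) : t₀ + s * (t - t₀) ∈ J :=
  hJ.add_smul_sub_mem ht₀ ht hs

lemma continuousOn_rescaledField (hJ : Convex ℝ J) (hf : ContinuousOn f (P ×ˢ J ×ˢ K))
    (hq : q ∈ P ×ˢ J ×ˢ J ×ˢ K) :
    ContinuousOn (Function.uncurry (rescaledField f q)) (Icc 0 1 ×ˢ K) := by
  have : ContinuousOn (fun w : ℝ × E => f (q.1, q.2.1 + w.1 * (q.2.2.1 - q.2.1), w.2))
      (Icc 0 1 ×ˢ K) :=
    hf.comp (f := fun w : ℝ × E => (q.1, q.2.1 + w.1 * (q.2.2.1 - q.2.1), w.2))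
      (by fun_prop) fun w hw => ⟨hq.1, rescaledTime_mem hJ hq.2.1 hq.2.2.1 hw.1, hw.2⟩
  exact this.const_smul _

variable [NormedSpace ℝ F]

/-- The curve `s ↦ (p, t₀ + s (t - t₀), y s)`, depending linearly on `q = (p, t₀, t, x₀)`
and on `y`. -/
noncomputable def rescaledCurve (F E : Type*) [NormedAddCommGroup F] [NormedSpace ℝ F]
    [NormedAddCommGroup E] [NormedSpace ℝ E] :
    (F × ℝ × ℝ × E) × C(I, E) →L[ℝ] C(I, F × ℝ × E) where
  toFun w := ⟨fun s => (w.1.1, w.1.2.1 + s * (w.1.2.2.1 - w.1.2.1), w.2 s), by fun_prop⟩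
  map_add' v w := by
    ext1 s
    simp only [ContinuousMap.coe_mk, ContinuousMap.add_apply, Prod.fst_add, Prod.snd_add,
      Prod.mk_add_mk]
    congr 2
    ring
  map_smul' c w := by
    ext1 s
    simp only [ContinuousMap.coe_mk, ContinuousMap.smul_apply, Prod.smul_fst, Prod.smul_snd,
      Prod.smul_mk, smul_eq_mul, RingHom.id_apply]
    congr 2
    ring
  cont := ContinuousMap.continuous_of_continuous_uncurry _ (by
    simp only [Function.uncurry_def, ContinuousMap.coe_mk]
    fun_prop)

lemma rescaledCurve_apply (w : (F × ℝ × ℝ × E) × C(I, E)) (s : I) :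
    rescaledCurve F E w s = (w.1.1, w.1.2.1 + s * (w.1.2.2.1 - w.1.2.1), w.2 s) := rfl

/-- The right-hand side of the integral equation of the rescaled initial value problem. -/
noncomputable def rescaledPicard (f : F × ℝ × E → E) (w : (F × ℝ × ℝ × E) × C(I, E)) : C(I, E) :=
  ContinuousLinearMap.const ℝ I w.1.2.2.2 +
    volterra E ((w.1.2.2.1 - w.1.2.1) • superposition I f (rescaledCurve F E w))

lemma rescaledCurve_mem (hJ : Convex ℝ J) {w : (F × ℝ × ℝ × E) × C(I, E)}
    (hw : w ∈ (P ×ˢ J ×ˢ J ×ˢ K) ×ˢ mapsInto I K) :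
    rescaledCurve F E w ∈ mapsInto I (P ×ˢ J ×ˢ K) := fun s =>
  ⟨hw.1.1, rescaledTime_mem hJ hw.1.2.1 hw.1.2.2.1 s.2, hw.2 s⟩

lemma contDiffOn_rescaledPicard (hJ : Convex ℝ J) (hC : Convex ℝ (P ×ˢ J ×ˢ K))
    (hCi : (interior (P ×ˢ J ×ˢ K)).Nonempty)
    (hf : ContDiffOn ℝ (⊤ : ℕ∞) f (P ×ˢ J ×ˢ K)) :
    ContDiffOn ℝ (⊤ : ℕ∞) (rescaledPicard f) ((P ×ˢ J ×ˢ J ×ˢ K) ×ˢ mapsInto I K) := by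
  have h1 := (contDiffOn_superposition (S := I) hC hCi hf).comp
    (rescaledCurve F E).contDiff.contDiffOn fun w hw => rescaledCurve_mem hJ hw
  have h2 : ContDiff ℝ (⊤ : ℕ∞) fun w : (F × ℝ × ℝ × E) × C(I, E) => w.1.2.2.1 - w.1.2.1 := by
    fun_prop
  have h3 : ContDiff ℝ (⊤ : ℕ∞) fun w : (F × ℝ × ℝ × E) × C(I, E) => w.1.2.2.2 := by fun_prop
  have h4 := (ContinuousLinearMap.const ℝ I : E →L[ℝ] C(I, E)).contDiff.comp h3
  exact h4.contDiffOn.add ((volterra E).contDiff.comp_contDiffOn (h2.contDiffOn.smul h1))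

lemma isUnit_one_sub_fderivWithin_rescaledPicard [CompleteSpace E] (hJ : Convex ℝ J)
    (hC : Convex ℝ (P ×ˢ J ×ˢ K)) (hCi : (interior (P ×ˢ J ×ˢ K)).Nonempty)
    (hf : ContDiffOn ℝ (⊤ : ℕ∞) f (P ×ˢ J ×ˢ K)) (hK : Convex ℝ K) (hKi : (interior K).Nonempty)
    {y : C(I, E)} (hq : q ∈ P ×ˢ J ×ˢ J ×ˢ K) (hy : y ∈ mapsInto I K) :
    IsUnit (1 - fderivWithin ℝ (rescaledPicard f) ((P ×ˢ J ×ˢ J ×ˢ K) ×ˢ mapsInto I K) (q, y) ∘L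
      ContinuousLinearMap.inr ℝ (F × ℝ × ℝ × E) C(I, E)) := by
  set f' := fderivWithin ℝ f (P ×ˢ J ×ˢ K)
  set a : C(I, F × ℝ × E →L[ℝ] E) := superposition I f' (rescaledCurve F E (q, y))
  set T : C(I, E) →L[ℝ] C(I, E) := (q.2.2.1 - q.2.1) • (pointwiseApply I (F × ℝ × E) E a ∘L
    (rescaledCurve F E ∘L ContinuousLinearMap.inr ℝ (F × ℝ × ℝ × E) C(I, E)))
  have hpair : HasFDerivWithinAt (fun z : C(I, E) => (q, z))
      (ContinuousLinearMap.inr ℝ (F × ℝ × ℝ × E) C(I, E)) (mapsInto I K) y :=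
    (hasFDerivAt_prodMk_right q y).hasFDerivWithinAt
  have hmaps : MapsTo (fun z : C(I, E) => (q, z)) (mapsInto I K)
      ((P ×ˢ J ×ˢ J ×ˢ K) ×ˢ mapsInto I K) := fun z hz => ⟨hq, hz⟩
  have hsup := hasFDerivWithinAt_superposition (S := I) hC
    (fun x hx => (hf.differentiableOn (by simp) x hx).hasFDerivWithinAt)
    (hf.continuousOn_fderivWithin (uniqueDiffOn_convex hC hCi) (by simp))
    (rescaledCurve_mem hJ (hmaps hy))
  have hcurve : HasFDerivWithinAt (fun z : C(I, E) => rescaledCurve F E (q, z))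
      (rescaledCurve F E ∘L ContinuousLinearMap.inr ℝ (F × ℝ × ℝ × E) C(I, E)) (mapsInto I K) y :=
    (rescaledCurve F E).hasFDerivAt.comp_hasFDerivWithinAt y hpair
  have hder : HasFDerivWithinAt (fun z : C(I, E) => rescaledPicard f (q, z)) (volterra E ∘L T)
      (mapsInto I K) y := by
    have h : HasFDerivWithinAt (fun z : C(I, E) => (q.2.2.1 - q.2.1) •
        superposition I f (rescaledCurve F E (q, z))) T (mapsInto I K) y :=
      (hsup.comp y hcurve fun z hz => rescaledCurve_mem hJ (hmaps hz)).const_smul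
        (q.2.2.1 - q.2.1)
    exact ((volterra E).hasFDerivAt.comp_hasFDerivWithinAt y h).const_add
      (ContinuousLinearMap.const ℝ I q.2.2.2)
  have hder' := ((contDiffOn_rescaledPicard hJ hC hCi hf).differentiableOn (by simp) (q, y)
    (hmaps hy)).hasFDerivWithinAt.comp y hpair hmaps
  rw [(uniqueDiffOn_mapsInto hK hKi y hy).eq hder' hder]
  refine isUnit_one_sub_volterra_comp (M := |q.2.2.1 - q.2.1| * ‖a‖) fun z s => ?_
  have hTz : T z s = (q.2.2.1 - q.2.1) • a s (0, 0, z s) := by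
    simp [T, rescaledCurve_apply]
  rw [hTz, norm_smul, Real.norm_eq_abs, mul_assoc]
  gcongr
  refine ((a s).le_opNorm _).trans ?_
  gcongr
  · exact a.norm_coe_le_norm s
  · simp

lemma exists_lipschitzOnWith_rescaledField (hJ : Convex ℝ J) (hC : UniqueDiffOn ℝ (P ×ˢ J ×ˢ K))
    (hf : ContDiffOn ℝ 1 f (P ×ˢ J ×ˢ K)) (hKc : IsCompact K) (hK : Convex ℝ K)
    (hq : q ∈ P ×ˢ J ×ˢ J ×ˢ K) :
    ∃ L : ℝ≥0, ∀ s ∈ Icc (0 : ℝ) 1, LipschitzOnWith L (rescaledField f q s) K := by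
  have hsub : {q.1} ×ˢ uIcc q.2.1 q.2.2.1 ×ˢ K ⊆ P ×ˢ J ×ˢ K :=
    prod_mono (singleton_subset_iff.2 hq.1)
      (prod_mono (hJ.ordConnected.uIcc_subset hq.2.1 hq.2.2.1) subset_rfl)
  have hc : IsCompact ({q.1} ×ˢ uIcc q.2.1 q.2.2.1 ×ˢ K) :=
    isCompact_singleton.prod (isCompact_uIcc.prod hKc)
  obtain ⟨M, hM⟩ := hc.exists_bound_of_continuousOn
    ((hf.continuousOn_fderivWithin hC le_rfl).mono hsub)
  have hL := ((convex_singleton q.1).prod ((convex_uIcc q.2.1 q.2.2.1).prod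
    hK)).lipschitzOnWith_of_nnnorm_hasFDerivWithin_le (f := f) (C := M.toNNReal)
    (fun x hx => ((hf.differentiableOn (by simp) x (hsub hx)).hasFDerivWithinAt).mono hsub)
    fun x hx => by
      rw [← NNReal.coe_le_coe, coe_nnnorm]
      exact (hM x hx).trans (Real.le_coe_toNNReal M)
  refine ⟨‖q.2.2.1 - q.2.1‖₊ * M.toNNReal, fun s hs => LipschitzOnWith.of_dist_le_mul
    fun x hx z hz => ?_⟩
  have hmem : ∀ x ∈ K, (q.1, q.2.1 + s * (q.2.2.1 - q.2.1), x) ∈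
      ({q.1} : Set F) ×ˢ uIcc q.2.1 q.2.2.1 ×ˢ K := fun x hx =>
    ⟨rfl, rescaledTime_mem (convex_uIcc _ _) left_mem_uIcc right_mem_uIcc hs, hx⟩
  have := hL.dist_le_mul _ (hmem x hx) _ (hmem z hz)
  simp only [dist_prod_same_left] at this
  rw [rescaledField, rescaledField, dist_smul₀, NNReal.coe_mul, coe_nnnorm, mul_assoc]
  gcongr

end Flow

section RescaledSolution

variable {F E : Type*} [NormedAddCommGroup E] [NormedSpace ℝ E]

/-- `y` solves the initial value problem given by `q = (p, t₀, t, x₀)` after the affine change of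
time that maps `[0, 1]` onto the interval from `t₀` to `t`. -/
def IsRescaledSolution (f : F × ℝ × E → E) (K : Set E) (q : F × ℝ × ℝ × E) (y : ℝ → E) : Prop :=
  y 0 = q.2.2.2 ∧ ∀ s ∈ Icc (0 : ℝ) 1, y s ∈ K ∧
    HasDerivWithinAt y (rescaledField f q s (y s)) (Icc 0 1) s

variable {P : Set F} {J : Set ℝ} {K : Set E} {f : F × ℝ × E → E} {q : F × ℝ × ℝ × E}

lemma IsRescaledSolution.mem_mapsInto {y : C(I, E)}
    (hy : IsRescaledSolution f K q (IccExtend zero_le_one y)) : y ∈ mapsInto I K := fun s => by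
  have := (hy.2 s s.2).1
  rwa [IccExtend_val] at this

lemma IsRescaledSolution.eqOn {y z : ℝ → E} {L : ℝ≥0} (hy : IsRescaledSolution f K q y)
    (hz : IsRescaledSolution f K q z)
    (hL : ∀ s ∈ Icc (0 : ℝ) 1, LipschitzOnWith L (rescaledField f q s) K) :
    EqOn y z (Icc 0 1) :=
  eqOn_integralCurves hL hy.2 hz.2 (hy.1.trans hz.1.symm)

lemma IsRescaledSolution.comp_mul {y : ℝ → E} {p : F} {t₀ t s : ℝ} {x₀ : E}
    (hy : IsRescaledSolution f K (p, t₀, t, x₀) y) (hs : s ∈ Icc (0 : ℝ) 1) :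
    IsRescaledSolution f K (p, t₀, t₀ + s * (t - t₀), x₀) fun r => y (r * s) := by
  refine ⟨by simpa using hy.1, fun r hr => ?_⟩
  have hmaps : MapsTo (fun r : ℝ => r * s) (Icc 0 1) (Icc 0 1) := fun r hr =>
    unitInterval.mul_mem hr hs
  have h := (hy.2 _ (hmaps hr)).2.scomp r
    (((hasDerivAt_id r).mul_const s).hasDerivWithinAt (s := Icc 0 1)) hmaps
  refine ⟨(hy.2 _ (hmaps hr)).1, h.congr_deriv ?_⟩
  simp only [rescaledField, smul_smul, add_sub_cancel_left, one_mul, mul_assoc]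

lemma isRescaledSolution_of_hasDerivWithinAt (hJ : Convex ℝ J) {y : ℝ → E} {p : F} {t₀ t : ℝ}
    {x₀ : E} (ht₀ : t₀ ∈ J) (ht : t ∈ J) (hyK : ∀ t ∈ J, y t ∈ K) (hy0 : y t₀ = x₀)
    (hy : ∀ t ∈ J, HasDerivWithinAt y (f (p, t, y t)) J t) :
    IsRescaledSolution f K (p, t₀, t, x₀) fun s => y (t₀ + s * (t - t₀)) := by
  refine ⟨by simpa using hy0, fun s hs => ?_⟩
  have hmaps : MapsTo (fun s : ℝ => t₀ + s * (t - t₀)) (Icc 0 1) J := fun s hs =>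
    rescaledTime_mem hJ ht₀ ht hs
  have h := (hy _ (hmaps hs)).scomp s
    ((((hasDerivAt_id s).mul_const (t - t₀)).const_add t₀).hasDerivWithinAt (s := Icc 0 1)) hmaps
  refine ⟨hyK _ (hmaps hs), h.congr_deriv ?_⟩
  simp only [rescaledField, one_mul]

variable [NormedAddCommGroup F]

lemma exists_isRescaledSolution [CompleteSpace E] (hJ : Convex ℝ J)
    (hf : ContinuousOn f (P ×ˢ J ×ˢ K)) (hK : IsCompact K) {L : ℝ≥0}
    (hL : ∀ s ∈ Icc (0 : ℝ) 1, LipschitzOnWith L (rescaledField f q s) K)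
    (h0 : ∀ p ∈ P, ∀ t ∈ J, ∀ x ∈ frontier K, f (p, t, x) = 0) (hq : q ∈ P ×ˢ J ×ˢ J ×ˢ K) :
    ∃ y : C(I, E), IsRescaledSolution f K q (IccExtend zero_le_one y) := by
  obtain ⟨y, hy0, hy⟩ := exists_integralCurve_of_frontier hK
    (continuousOn_rescaledField hJ hf hq) hL
    (fun s hs x hx => by
      rw [rescaledField, h0 _ hq.1 _ (rescaledTime_mem hJ hq.2.1 hq.2.2.1 hs) x hx, smul_zero])
    hq.2.2.2
  have hyc : ContinuousOn y (Icc 0 1) := fun s hs => (hy s hs).2.continuousWithinAt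
  have heq : ∀ s ∈ Icc (0 : ℝ) 1, IccExtend zero_le_one ((Icc 0 1).domRestrict y) s = y s :=
    fun s hs => IccExtend_of_mem _ _ hs
  refine ⟨⟨(Icc 0 1).domRestrict y, hyc.domRestrict⟩, (heq 0 ⟨le_rfl, zero_le_one⟩).trans hy0,
    fun s hs => ?_⟩
  rw [ContinuousMap.coe_mk, heq s hs]
  exact ⟨(hy s hs).1, (hy s hs).2.congr heq (heq s hs)⟩

/-- Gronwall's inequality makes the rescaled solutions depend continuously on the data. -/
lemma continuousOn_rescaledSolution (hJ : Convex ℝ J)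
    (hf : ContinuousOn f (P ×ˢ J ×ˢ K)) (hK : IsCompact K)
    (hL : ∀ q ∈ P ×ˢ J ×ˢ J ×ˢ K, ∃ L : ℝ≥0, ∀ s ∈ Icc (0 : ℝ) 1,
      LipschitzOnWith L (rescaledField f q s) K) {y : F × ℝ × ℝ × E → C(I, E)}
    (hy : ∀ q ∈ P ×ˢ J ×ˢ J ×ˢ K, IsRescaledSolution f K q (IccExtend zero_le_one (y q))) :
    ContinuousOn y (P ×ˢ J ×ˢ J ×ˢ K) := by
  have := isCompact_iff_compactSpace.1 hK
  let u (q : F × ℝ × ℝ × E) : C(I × K, F × ℝ × E) :=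
    ⟨fun w => (q.1, q.2.1 + w.1 * (q.2.2.1 - q.2.1), w.2), by fun_prop⟩
  have hu : Continuous u := ContinuousMap.continuous_of_continuous_uncurry _ (by
    simp only [Function.uncurry_def, u, ContinuousMap.coe_mk]
    fun_prop)
  have hmem : MapsTo u (P ×ˢ J ×ˢ J ×ˢ K) (mapsInto (I × K) (P ×ˢ J ×ˢ K)) := fun q hq w =>
    ⟨hq.1, rescaledTime_mem hJ hq.2.1 hq.2.2.1 w.1.2, w.2.2⟩
  let G (q : F × ℝ × ℝ × E) : C(I × K, E) := (q.2.2.1 - q.2.1) • superposition (I × K) f (u q)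
  have hG : ContinuousOn G (P ×ˢ J ×ˢ J ×ˢ K) :=
    ContinuousOn.smul (f := fun q => q.2.2.1 - q.2.1) (by fun_prop)
      ((continuousOn_superposition (S := I × K) hf).comp hu.continuousOn hmem)
  have hGapp : ∀ q ∈ P ×ˢ J ×ˢ J ×ˢ K, ∀ w : I × K, G q w = rescaledField f q w.1 w.2 :=
    fun q hq w => by
      rw [ContinuousMap.smul_apply, superposition_apply hf (hmem hq)]
      rfl
  intro q₀ hq₀
  obtain ⟨L, hL⟩ := hL q₀ hq₀
  have hlim : Tendsto (fun q => gronwallBound (dist q.2.2.2 q₀.2.2.2) L (dist (G q) (G q₀)) 1)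
      (𝓝[P ×ˢ J ×ˢ J ×ˢ K] q₀) (𝓝 0) := by
    refine (tendsto_gronwallBound_zero L 1).comp (Tendsto.prodMk_nhds ?_ ?_)
    · exact (tendsto_iff_dist_tendsto_zero.1
        (Continuous.tendsto (f := fun q : F × ℝ × ℝ × E => q.2.2.2) (by fun_prop) q₀)).mono_left
        nhdsWithin_le_nhds
    · exact tendsto_iff_dist_tendsto_zero.1 (hG q₀ hq₀)
  refine tendsto_iff_dist_tendsto_zero.2 (squeeze_zero' (.of_forall fun _ => dist_nonneg) ?_ hlim)
  filter_upwards [self_mem_nhdsWithin] with q hq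
  refine (ContinuousMap.dist_le_iff_of_nonempty).2 fun s => ?_
  have := dist_integralCurves_le (ε := dist (G q) (G q₀)) hL (fun s hs x hx => ?_)
    (hy q hq).2 (hy q₀ hq₀).2 s.2
  · rwa [IccExtend_val, IccExtend_val, (hy q hq).1, (hy q₀ hq₀).1] at this
  · have := ContinuousMap.dist_apply_le_dist (f := G q) (g := G q₀) (⟨s, hs⟩, ⟨x, hx⟩)
    rwa [hGapp q hq, hGapp q₀ hq₀] at this

variable [NormedSpace ℝ F]

lemma IsRescaledSolution.rescaledPicard_eq [CompleteSpace E] (hJ : Convex ℝ J)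
    (hf : ContinuousOn f (P ×ˢ J ×ˢ K)) (hq : q ∈ P ×ˢ J ×ˢ J ×ˢ K) {y : C(I, E)}
    (hy : IsRescaledSolution f K q (IccExtend zero_le_one y)) : rescaledPicard f (q, y) = y := by
  set z : C(I, E) := (q.2.2.1 - q.2.1) • superposition I f (rescaledCurve F E (q, y))
  have hmem := rescaledCurve_mem (w := (q, y)) hJ ⟨hq, hy.mem_mapsInto⟩
  have hz : ∀ s : I, z s = rescaledField f q s (IccExtend zero_le_one y s) := fun s => by
    rw [IccExtend_val, ContinuousMap.smul_apply, superposition_apply hf hmem]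
    rfl
  have hder : ∀ s ∈ Icc (0 : ℝ) 1, HasDerivWithinAt
      (fun s => q.2.2.2 + IccExtend zero_le_one (volterra E z) s)
      (rescaledField f q s (IccExtend zero_le_one y s)) (Icc 0 1) s := fun s hs => by
    have := (hasDerivWithinAt_volterra z ⟨s, hs⟩).const_add q.2.2.2
    rwa [hz] at this
  have heq := eq_of_has_deriv_right_eq (a := 0) (b := 1)
    (fun s hs => (hder s (Ico_subset_Icc_self hs)).Ici_of_Icc hs)
    (fun s hs => (hy.2 s (Ico_subset_Icc_self hs)).2.Ici_of_Icc hs)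
    (fun s hs => (hder s hs).continuousWithinAt) (fun s hs => (hy.2 s hs).2.continuousWithinAt)
    (by
      rw [hy.1, IccExtend_of_mem _ _ (left_mem_Icc.2 zero_le_one), volterra_apply]
      simp)
  ext s
  have := heq s s.2
  rwa [IccExtend_val, IccExtend_val] at this

lemma contDiffOn_rescaledSolution [CompleteSpace E] (hP : Convex ℝ P) (hPi : (interior P).Nonempty)
    (hJ : Convex ℝ J) (hJi : (interior J).Nonempty) (hKc : IsCompact K) (hK : Convex ℝ K)
    (hKi : (interior K).Nonempty) (hf : ContDiffOn ℝ (⊤ : ℕ∞) f (P ×ˢ J ×ˢ K))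
    (hL : ∀ q ∈ P ×ˢ J ×ˢ J ×ˢ K, ∃ L : ℝ≥0, ∀ s ∈ Icc (0 : ℝ) 1,
      LipschitzOnWith L (rescaledField f q s) K) {y : F × ℝ × ℝ × E → C(I, E)}
    (hy : ∀ q ∈ P ×ˢ J ×ˢ J ×ˢ K, IsRescaledSolution f K q (IccExtend zero_le_one (y q))) :
    ContDiffOn ℝ (⊤ : ℕ∞) y (P ×ˢ J ×ˢ J ×ˢ K) := by
  have hC : Convex ℝ (P ×ˢ J ×ˢ K) := hP.prod (hJ.prod hK)
  have hCi : (interior (P ×ˢ J ×ˢ K)).Nonempty := by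
    simp only [interior_prod_eq]
    exact hPi.prod (hJi.prod hKi)
  have hQi : (interior (P ×ˢ J ×ˢ J ×ˢ K)).Nonempty := by
    simp only [interior_prod_eq]
    exact hPi.prod (hJi.prod (hJi.prod hKi))
  exact contDiffOn_of_fixedPoint
    (uniqueDiffOn_convex (hP.prod (hJ.prod (hJ.prod hK))) hQi) (uniqueDiffOn_mapsInto hK hKi)
    (contDiffOn_rescaledPicard hJ hC hCi hf) (fun q hq => (hy q hq).mem_mapsInto)
    (continuousOn_rescaledSolution hJ hf.continuousOn hKc hL hy)
    (fun q hq => (hy q hq).rescaledPicard_eq hJ hf.continuousOn hq)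
    fun q hq => isUnit_one_sub_fderivWithin_rescaledPicard hJ hC hCi hf hK hKi hq
      (hy q hq).mem_mapsInto

end RescaledSolution

lemma hasDerivWithinAt_of_comp_rescaledTime {E : Type*} [NormedAddCommGroup E] [NormedSpace ℝ E]
    {J : Set ℝ} (hJ : Convex ℝ J) {φ : ℝ → E} {v : E} {t₀ t s : ℝ} (ht₀ : t₀ ∈ J) (ht : t ∈ J)
    (hne : t ≠ t₀) (hs : s ∈ Icc (0 : ℝ) 1)
    (hφ : DifferentiableWithinAt ℝ φ J (t₀ + s * (t - t₀)))
    (h : HasDerivWithinAt (fun r => φ (t₀ + r * (t - t₀))) ((t - t₀) • v) (Icc 0 1) s) :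
    HasDerivWithinAt φ v J (t₀ + s * (t - t₀)) := by
  have hcomp := hφ.hasDerivWithinAt.scomp s
    ((((hasDerivAt_id s).mul_const (t - t₀)).const_add t₀).hasDerivWithinAt (s := Icc 0 1))
    fun r hr => rescaledTime_mem hJ ht₀ ht hr
  rw [one_mul] at hcomp
  exact hφ.hasDerivWithinAt.congr_deriv (smul_right_injective E (sub_ne_zero.2 hne)
    ((uniqueDiffOn_Icc_zero_one s hs).eq_deriv _ hcomp h))

/-- Theorem B:  let `J ⊆ ℝ` be a non-degenerate interval, `K ⊆ ℝⁿ` a compact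
convex set with non-empty interior, `P ⊆ F` a convex subset with non-empty
interior of a real Banach space `F`, and `f : P × J × K → ℝⁿ` a smooth map
with `f (p, t, x) = 0` for all `p ∈ P`, `t ∈ J`, `x ∈ frontier K`.  Then for
all `p ∈ P`, `t₀ ∈ J`, `x₀ ∈ K` the initial value problem
`y' t = f (p, t, y t)`, `y t₀ = x₀` has a unique solution `y : J → K` defined
on all of `J`, and the associated flow `(p, t₀, t, x₀) ↦ y_{p,t₀,x₀} t` is
smooth. -/
theorem exists_unique_global_solution_and_contDiffOn_flow
    {F : Type*} [NormedAddCommGroup F] [NormedSpace ℝ F] [CompleteSpace F]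
    {n : ℕ} (J : Set ℝ) (hJ : J.OrdConnected)
    (hJnd : ∃ a ∈ J, ∃ b ∈ J, a < b)
    (K : Set (EuclideanSpace ℝ (Fin n)))
    (hK : IsCompact K) (hKconv : Convex ℝ K) (hKint : (interior K).Nonempty)
    (P : Set F) (hP : Convex ℝ P) (hPint : (interior P).Nonempty)
    (f : F × ℝ × EuclideanSpace ℝ (Fin n) → EuclideanSpace ℝ (Fin n))
    (hf : ContDiffOn ℝ (⊤ : ℕ∞) f (P ×ˢ J ×ˢ K))
    (hfbd : ∀ p ∈ P, ∀ t ∈ J, ∀ x ∈ frontier K, f (p, t, x) = 0) :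
    ∃ Y : F × ℝ × ℝ × EuclideanSpace ℝ (Fin n) → EuclideanSpace ℝ (Fin n),
      ContDiffOn ℝ (⊤ : ℕ∞) Y (P ×ˢ J ×ˢ J ×ˢ K) ∧
      ∀ p ∈ P, ∀ t₀ ∈ J, ∀ x₀ ∈ K,
        (Y (p, t₀, t₀, x₀) = x₀) ∧
        (∀ t ∈ J, Y (p, t₀, t, x₀) ∈ K ∧
          HasDerivWithinAt (fun s => Y (p, t₀, s, x₀))
            (f (p, t, Y (p, t₀, t, x₀))) J t) ∧
        (∀ y : ℝ → EuclideanSpace ℝ (Fin n), (∀ t ∈ J, y t ∈ K) →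
          y t₀ = x₀ →
          (∀ t ∈ J, HasDerivWithinAt y (f (p, t, y t)) J t) →
          ∀ t ∈ J, y t = Y (p, t₀, t, x₀)) := by
  have hJc : Convex ℝ J := hJ.convex
  have hJi : (interior J).Nonempty := by
    obtain ⟨a, ha, b, hb, hab⟩ := hJnd
    exact (nonempty_Ioo.2 hab).mono
      (interior_maximal (Ioo_subset_Icc_self.trans (hJ.out ha hb)) isOpen_Ioo)
  have hC : UniqueDiffOn ℝ (P ×ˢ J ×ˢ K) :=
    (uniqueDiffOn_convex hP hPint).prod
      ((uniqueDiffOn_convex hJc hJi).prod (uniqueDiffOn_convex hKconv hKint))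
  have hL : ∀ q ∈ P ×ˢ J ×ˢ J ×ˢ K, ∃ L : ℝ≥0, ∀ s ∈ Icc (0 : ℝ) 1,
      LipschitzOnWith L (rescaledField f q s) K := fun q hq =>
    exists_lipschitzOnWith_rescaledField hJc hC (hf.of_le (mod_cast le_top)) hK hKconv hq
  have hex : ∀ q ∈ P ×ˢ J ×ˢ J ×ˢ K, ∃ y : C(I, EuclideanSpace ℝ (Fin n)),
      IsRescaledSolution f K q (IccExtend zero_le_one y) := fun q hq =>
    exists_isRescaledSolution hJc hf.continuousOn hK (hL q hq).choose_spec hfbd hq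
  choose! y hy using hex
  have hone : (1 : ℝ) ∈ Icc (0 : ℝ) 1 := right_mem_Icc.2 zero_le_one
  have heq : ∀ q ∈ P ×ˢ J ×ˢ J ×ˢ K, ∀ z : ℝ → EuclideanSpace ℝ (Fin n),
      IsRescaledSolution f K q z → z 1 = y q 1 := fun q hq z hz => by
    obtain ⟨L, hLq⟩ := hL q hq
    exact (hz.eqOn (hy q hq) hLq hone).trans (IccExtend_right _ _)
  have hsmooth : ContDiffOn ℝ (⊤ : ℕ∞) (fun q => y q 1) (P ×ˢ J ×ˢ J ×ˢ K) :=
    (ContinuousMap.evalCLM ℝ (1 : I) :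
      C(I, EuclideanSpace ℝ (Fin n)) →L[ℝ] EuclideanSpace ℝ (Fin n)).contDiff.comp_contDiffOn
      (contDiffOn_rescaledSolution hP hPint hJc hJi hK hKconv hKint hf hL hy)
  refine ⟨fun q => y q 1, hsmooth, fun p hp t₀ ht₀ x₀ hx₀ => ?_⟩
  have hq : ∀ t ∈ J, (p, t₀, t, x₀) ∈ P ×ˢ J ×ˢ J ×ˢ K := fun t ht => ⟨hp, ht₀, ht, hx₀⟩
  have hcurve : ∀ t ∈ J, ∀ s ∈ Icc (0 : ℝ) 1,
      y (p, t₀, t₀ + s * (t - t₀), x₀) 1 = IccExtend zero_le_one (y (p, t₀, t, x₀)) s :=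
    fun t ht s hs => by
      have := heq _ (hq _ (rescaledTime_mem hJc ht₀ ht hs)) _ ((hy _ (hq t ht)).comp_mul hs)
      rw [← this, one_mul]
  have hder : ∀ t ∈ J, t ≠ t₀ → ∀ s ∈ Icc (0 : ℝ) 1,
      HasDerivWithinAt (fun s => y (p, t₀, s, x₀) 1)
        (f (p, t₀ + s * (t - t₀), y (p, t₀, t₀ + s * (t - t₀), x₀) 1)) J (t₀ + s * (t - t₀)) :=
    fun t ht hne s hs => by
      refine hasDerivWithinAt_of_comp_rescaledTime hJc ht₀ ht hne hs ?_ ?_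
      · exact ((hsmooth.differentiableOn (by simp) _
          (hq _ (rescaledTime_mem hJc ht₀ ht hs))).comp _
          (f := fun s : ℝ => (p, t₀, s, x₀)) (by fun_prop) fun t ht => hq t ht)
      · rw [hcurve t ht s hs]
        exact ((hy _ (hq t ht)).2 s hs).2.congr (hcurve t ht) (hcurve t ht s hs)
  refine ⟨?_, fun t ht => ⟨(hy _ (hq t ht)).mem_mapsInto 1, ?_⟩, fun z hzK hz0 hz t ht => ?_⟩
  · have := hcurve t₀ ht₀ 0 (left_mem_Icc.2 zero_le_one)
    rw [zero_mul, add_zero] at this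
    exact this.trans (hy _ (hq t₀ ht₀)).1
  · by_cases h : t = t₀
    · obtain ⟨t₁, ht₁, hne⟩ : ∃ t₁ ∈ J, t₁ ≠ t₀ := by
        obtain ⟨a, ha, b, hb, hab⟩ := hJnd
        by_cases hat : a = t₀
        · exact ⟨b, hb, (hat ▸ hab).ne'⟩
        · exact ⟨a, ha, hat⟩
      have := hder t₁ ht₁ hne 0 (left_mem_Icc.2 zero_le_one)
      rw [zero_mul, add_zero] at this
      rwa [h]
    · have := hder t ht h 1 hone
      rwa [one_mul, add_sub_cancel] at this
  · have := heq _ (hq t ht) _ (isRescaledSolution_of_hasDerivWithinAt hJc ht₀ ht hzK hz0 hz)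
    rwa [one_mul, add_sub_cancel] at this
end

section
/- Let K ⊆ ℝⁿ be a compact convex set with non-empty interior, 0 < θ ≤ 1/3, and γ : [0,1] × K → ℝⁿ a continuous map such that γ(t, x) = 0 for all t ∈ [0,1] and all x in the frontier of K, and such that for every t ∈ [0,1] the map γ(t, ·) : K → ℝⁿ is Lipschitz with Lipschitz constant at most θ. Then for every x₀ ∈ K there is a unique continuously differentiable curve y : [0,1] → K with y(0) = x₀ and y'(t) = γ(t, y(t)) for all t ∈ [0,1]; moreover, if x₀ lies in the interior of K, then y(t) ∈ closedBall(x₀, dist(x₀, ∂K)/2) for all t ∈ [0,1]. -/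
open Set Metric
open scoped NNReal

/-- The **Picard-Lindelöf theorem**, with the additional information that the solution stays in the
closed ball on which the hypotheses on the vector field hold. -/
theorem IsPicardLindelof.exists_eq_forall_mem_Icc_mem_closedBall_hasDerivWithinAt
    {E : Type*} [NormedAddCommGroup E] [NormedSpace ℝ E] [CompleteSpace E]
    {f : ℝ → E → E} {tmin tmax : ℝ} {t₀ : Icc tmin tmax} {x₀ x : E} {a r L K : ℝ≥0}
    (hf : IsPicardLindelof f t₀ x₀ a r L K) (hx : x ∈ closedBall x₀ r) :
    ∃ α : ℝ → E, α t₀ = x ∧ (∀ t, α t ∈ closedBall x₀ a) ∧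
      ∀ t ∈ Icc tmin tmax, HasDerivWithinAt α (f t (α t)) (Icc tmin tmax) t := by
  obtain ⟨α, hα⟩ := ODE.FunSpace.exists_isFixedPt_next hf hx
  refine ⟨α.compProj, by rw [ODE.FunSpace.compProj_val, ← hα, ODE.FunSpace.next_apply₀],
    fun t ↦ α.compProj_mem_closedBall hf.mul_max_le, fun t ht ↦ ?_⟩
  apply ODE.hasDerivWithinAt_picard_Icc t₀.2 hf.continuousOn_uncurry
    α.continuous_compProj.continuousOn (fun _ _ ↦ α.compProj_mem_closedBall hf.mul_max_le)
    x ht |>.congr_of_mem _ ht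
  intro t' ht'
  nth_rw 1 [← hα]
  rw [ODE.FunSpace.compProj_of_mem ht', ODE.FunSpace.next_apply]

/-- A point in the interior of a compact set `K` admits a nearest point `p` in the frontier of `K`,
and the closed ball of half the radius is contained in `K`. -/
theorem IsCompact.exists_mem_frontier_closedBall_half_subset
    {E : Type*} [NormedAddCommGroup E] [NormedSpace ℝ E] [Nontrivial E] {K : Set E}
    (hK : IsCompact K) {x : E} (hx : x ∈ interior K) :
    ∃ p ∈ frontier K, infDist x (frontier K) = dist x p ∧
      closedBall x (infDist x (frontier K) / 2) ⊆ K := by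
  obtain ⟨q, hq, hqd⟩ := hK.exists_mem_frontier_infDist_compl_eq_dist (interior_subset hx)
  have hfc : IsCompact (frontier K) :=
    hK.of_isClosed_subset isClosed_frontier hK.isClosed.frontier_subset
  obtain ⟨p, hp, hpd⟩ := hfc.exists_infDist_eq_dist ⟨q, hq⟩ x
  refine ⟨p, hp, hpd, fun z hz ↦ by_contra fun hzK ↦ ?_⟩
  have hpos : 0 < dist x p := dist_pos.2 fun h ↦ hp.2 (h ▸ hx)
  have h₁ : infDist x (frontier K) ≤ dist x q := infDist_le_dist_of_mem hq
  have h₂ : infDist x Kᶜ ≤ dist x z := infDist_le_dist_of_mem hzK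
  rw [mem_closedBall'] at hz
  linarith

/-- A time-dependent vector field on `K` which vanishes on the frontier of the compact set `K` and
is Lipschitz with constant at most `1 / 3` has an integral curve on `[0, 1]` starting at any
interior point `x₀` of `K`, which stays within half the distance of `x₀` to the frontier. -/
theorem IsCompact.exists_integralCurve_of_eq_zero_on_frontier
    {E : Type*} [NormedAddCommGroup E] [NormedSpace ℝ E] [CompleteSpace E] [Nontrivial E]
    {K : Set E} (hK : IsCompact K) {θ : ℝ≥0} (hθ : (θ : ℝ) ≤ 1 / 3) {v : ℝ → E → E}
    (hcont : ∀ x ∈ K, ContinuousOn (v · x) (Icc 0 1))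
    (hbd : ∀ t ∈ Icc (0 : ℝ) 1, ∀ x ∈ frontier K, v t x = 0)
    (hlip : ∀ t ∈ Icc (0 : ℝ) 1, LipschitzOnWith θ (v t) K)
    {x₀ : E} (hx₀ : x₀ ∈ interior K) :
    ∃ y : ℝ → E, y 0 = x₀ ∧
      (∀ t, y t ∈ K ∩ closedBall x₀ (infDist x₀ (frontier K) / 2)) ∧
      ∀ t ∈ Icc (0 : ℝ) 1, HasDerivWithinAt y (v t (y t)) (Icc 0 1) t := by
  obtain ⟨p, hp, hpd, hsub⟩ := hK.exists_mem_frontier_closedBall_half_subset hx₀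
  have hR : 0 ≤ infDist x₀ (frontier K) / 2 := div_nonneg infDist_nonneg zero_le_two
  let a : ℝ≥0 := ⟨infDist x₀ (frontier K) / 2, hR⟩
  have haR : (a : ℝ) = infDist x₀ (frontier K) / 2 := rfl
  rw [← haR] at hsub ⊢
  have hPL : IsPicardLindelof v (⟨0, by simp⟩ : Icc (0 : ℝ) 1) x₀ a 0 a θ :=
    { lipschitzOnWith := fun t ht ↦ (hlip t ht).mono hsub
      continuousOn := fun x hx ↦ hcont x (hsub hx)
      norm_le := fun t ht x hx ↦ by
        have h₁ := (hlip t ht).dist_le_mul x (hsub hx) p (hK.isClosed.frontier_subset hp)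
        rw [hbd t ht p hp, dist_zero_right] at h₁
        have h₂ := dist_triangle x x₀ p
        have h₃ := mem_closedBall.1 hx
        have h₄ : dist x p ≤ 3 * a := by linarith
        calc ‖v t x‖ ≤ θ * dist x p := h₁
          _ ≤ 1 / 3 * (3 * a) := by gcongr
          _ = a := by ring
      mul_max_le := by simp }
  obtain ⟨y, hy₀, hyb, hyd⟩ :=
    hPL.exists_eq_forall_mem_Icc_mem_closedBall_hasDerivWithinAt (mem_closedBall_self le_rfl)
  exact ⟨y, hy₀, fun t ↦ ⟨hsub (hyb t), hyb t⟩, hyd⟩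

/-- Uniqueness of integral curves in a set on which the vector field is Lipschitz, for curves which
are differentiable within a closed interval. -/
theorem eqOn_Icc_of_hasDerivWithinAt_Icc
    {E : Type*} [NormedAddCommGroup E] [NormedSpace ℝ E] {K : Set E} {θ : ℝ≥0} {v : ℝ → E → E}
    {a b : ℝ} (hlip : ∀ t ∈ Icc a b, LipschitzOnWith θ (v t) K) {y z : ℝ → E}
    (hyK : ∀ t ∈ Icc a b, y t ∈ K)
    (hy : ∀ t ∈ Icc a b, HasDerivWithinAt y (v t (y t)) (Icc a b) t)
    (hzK : ∀ t ∈ Icc a b, z t ∈ K)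
    (hz : ∀ t ∈ Icc a b, HasDerivWithinAt z (v t (z t)) (Icc a b) t)
    (hyz : y a = z a) : EqOn y z (Icc a b) := by
  have hright : ∀ w : ℝ → E, (∀ t ∈ Icc a b, HasDerivWithinAt w (v t (w t)) (Icc a b) t) →
      ∀ t ∈ Ico a b, HasDerivWithinAt w (v t (w t)) (Ici t) t := fun w hw t ht ↦
    (hw t (Ico_subset_Icc_self ht)).mono_of_mem_nhdsWithin (Icc_mem_nhdsGE_of_mem ht)
  exact ODE_solution_unique_of_mem_Icc_right (s := fun _ ↦ K)
    (fun t ht ↦ hlip t (Ico_subset_Icc_self ht))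
    (fun t ht ↦ (hy t ht).continuousWithinAt) (hright y hy)
    (fun t ht ↦ hyK t (Ico_subset_Icc_self ht))
    (fun t ht ↦ (hz t ht).continuousWithinAt) (hright z hz)
    (fun t ht ↦ hzK t (Ico_subset_Icc_self ht)) hyz


/-- Let `K ⊆ ℝⁿ` be a compact convex set with non-empty interior,
`0 < θ ≤ 1/3`, and `γ : [0,1] × K → ℝⁿ` continuous, vanishing on
`[0,1] × ∂K`, with `γ (t, ·)` Lipschitz with constant at most `θ` for each
`t`.  Then for every `x₀ ∈ K` there is a unique `C¹`-curve
`y : [0,1] → K` with `y 0 = x₀` and `y' t = γ (t, y t)`; moreover if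
`x₀ ∈ interior K`, then `y t ∈ closedBall x₀ (dist (x₀, ∂K) / 2)` for all
`t ∈ [0,1]`. -/
theorem exists_unique_solution_in_K_of_small_lipschitz_vanishing_on_frontier
    {n : ℕ} (K : Set (EuclideanSpace ℝ (Fin n)))
    (hK : IsCompact K) (hKconv : Convex ℝ K) (hKint : (interior K).Nonempty)
    (θ : ℝ) (hθ0 : 0 < θ) (hθ : θ ≤ 1 / 3)
    (γ : ℝ × EuclideanSpace ℝ (Fin n) → EuclideanSpace ℝ (Fin n))
    (hγcont : ContinuousOn γ (Set.Icc (0 : ℝ) 1 ×ˢ K))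
    (hγbd : ∀ t ∈ Set.Icc (0 : ℝ) 1, ∀ x ∈ frontier K, γ (t, x) = 0)
    (hγlip : ∀ t ∈ Set.Icc (0 : ℝ) 1, ∀ x ∈ K, ∀ y ∈ K,
      ‖γ (t, y) - γ (t, x)‖ ≤ θ * ‖y - x‖) :
    ∀ x₀ ∈ K, ∃ y : ℝ → EuclideanSpace ℝ (Fin n),
      ((∀ t ∈ Set.Icc (0 : ℝ) 1, y t ∈ K) ∧ y 0 = x₀ ∧
        ∀ t ∈ Set.Icc (0 : ℝ) 1,
          HasDerivWithinAt y (γ (t, y t)) (Set.Icc (0 : ℝ) 1) t) ∧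
      (∀ z : ℝ → EuclideanSpace ℝ (Fin n),
        ((∀ t ∈ Set.Icc (0 : ℝ) 1, z t ∈ K) ∧ z 0 = x₀ ∧
          ∀ t ∈ Set.Icc (0 : ℝ) 1,
            HasDerivWithinAt z (γ (t, z t)) (Set.Icc (0 : ℝ) 1) t) →
        ∀ t ∈ Set.Icc (0 : ℝ) 1, z t = y t) ∧
      (x₀ ∈ interior K → ∀ t ∈ Set.Icc (0 : ℝ) 1,
        y t ∈ Metric.closedBall x₀ (Metric.infDist x₀ (frontier K) / 2)) := by
  intro x₀ hx₀
  have hlip : ∀ t ∈ Icc (0 : ℝ) 1, LipschitzOnWith ⟨θ, hθ0.le⟩ (fun x ↦ γ (t, x)) K :=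
    fun t ht ↦ LipschitzOnWith.of_dist_le_mul fun x hx y hy ↦ by
      rw [dist_eq_norm, dist_eq_norm]
      exact hγlip t ht y hy x hx
  have hcont : ∀ x ∈ K, ContinuousOn (fun t ↦ γ (t, x)) (Icc 0 1) := fun x hx ↦
    hγcont.comp (by fun_prop) fun t ht ↦ ⟨ht, hx⟩
  obtain ⟨y, hy₀, hyK, hyd, hyb⟩ : ∃ y : ℝ → EuclideanSpace ℝ (Fin n), y 0 = x₀ ∧
      (∀ t ∈ Icc (0 : ℝ) 1, y t ∈ K) ∧
      (∀ t ∈ Icc (0 : ℝ) 1, HasDerivWithinAt y (γ (t, y t)) (Icc (0 : ℝ) 1) t) ∧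
      (x₀ ∈ interior K → ∀ t ∈ Icc (0 : ℝ) 1,
        y t ∈ closedBall x₀ (infDist x₀ (frontier K) / 2)) := by
    by_cases hzero : ∀ t ∈ Icc (0 : ℝ) 1, γ (t, x₀) = 0
    · refine ⟨fun _ ↦ x₀, rfl, fun _ _ ↦ hx₀, fun t ht ↦ ?_, fun _ _ _ ↦
        mem_closedBall_self (div_nonneg infDist_nonneg zero_le_two)⟩
      rw [hzero t ht]
      exact hasDerivWithinAt_const _ _ _
    · push Not at hzero
      obtain ⟨s, hs, hne⟩ := hzero
      have : Nontrivial (EuclideanSpace ℝ (Fin n)) := ⟨_, _, hne⟩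
      have hint : x₀ ∈ interior K := by
        by_contra h
        exact hne (hγbd s hs x₀ ⟨subset_closure hx₀, h⟩)
      obtain ⟨y, hy₀, hyb, hyd⟩ := hK.exists_integralCurve_of_eq_zero_on_frontier
        (θ := ⟨θ, hθ0.le⟩) (v := fun t x ↦ γ (t, x)) hθ hcont hγbd hlip hint
      exact ⟨y, hy₀, fun t _ ↦ (hyb t).1, hyd, fun _ t _ ↦ (hyb t).2⟩
  refine ⟨y, ⟨hyK, hy₀, hyd⟩, fun z ⟨hzK, hz₀, hzd⟩ ↦ ?_, hyb⟩
  exact eqOn_Icc_of_hasDerivWithinAt_Icc (v := fun t x ↦ γ (t, x)) hlip hzK hzd hyK hyd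
    (hz₀.trans hy₀.symm)
end

section
/- Let J ⊆ ℝ be a non-degenerate interval, K ⊆ ℝⁿ a compact convex set with non-empty interior, and f : J × K → ℝⁿ a continuous map such that f(t, x) = 0 for all t ∈ J and all x in the frontier of K, and such that for every compact subinterval C ⊆ J one has sup_{t∈C} Lip(f(t, ·)) < ∞. Then for every t₀ ∈ J and x₀ ∈ K there exists a unique map y : J → K such that y(t₀) = x₀ and y is differentiable within J at every t ∈ J with derivative f(t, y(t)); that is, the maximal solution of the initial value problem y'(t) = f(t, y(t)), y(t₀) = x₀ is defined on all of J. -/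
open Set Topology NNReal

section

variable {E : Type*} [NormedAddCommGroup E] [NormedSpace ℝ E]

/-- A point of `s` and a point outside `s` are separated by a frontier point of `s` lying on the
segment between them. -/
lemma exists_mem_frontier_dist_le {s : Set E} {x y : E} (hx : x ∈ s) (hy : y ∉ s) :
    ∃ z ∈ frontier s, dist z x ≤ dist y x := by
  obtain ⟨z, hz, hzs⟩ : ∃ z ∈ segment ℝ x y, z ∈ frontier s := by
    by_contra! hf
    obtain ⟨w, -, hwi, hwc⟩ := (convex_segment x y).isPreconnected (interior s) (closure s)ᶜ
      isOpen_interior isClosed_closure.isOpen_compl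
      (fun w hw => by
        by_contra h
        rw [mem_union, mem_compl_iff, not_or, not_not] at h
        exact hf w hw ⟨h.2, h.1⟩)
      ⟨x, left_mem_segment ℝ x y, by
        by_contra h
        exact hf x (left_mem_segment ℝ x y) ⟨subset_closure hx, h⟩⟩
      ⟨y, right_mem_segment ℝ x y, fun h =>
        hf y (right_mem_segment ℝ x y) ⟨h, fun h' => hy (interior_subset h')⟩⟩
    exact hwc (interior_subset_closure hwi)
  refine ⟨z, hzs, ?_⟩
  have h := dist_add_dist_of_mem_segment hz
  rw [dist_comm z x, dist_comm y x]
  linarith [dist_nonneg (x := z) (y := y)]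

/-- Extending by zero a map which is Lipschitz on a closed set and vanishes on its frontier
preserves the Lipschitz constant. -/
lemma LipschitzOnWith.lipschitzWith_indicator {F : Type*} [NormedAddCommGroup F] {s : Set E}
    {L : ℝ≥0} {g : E → F} (hg : LipschitzOnWith L g s) (hs : IsClosed s)
    (h0 : ∀ x ∈ frontier s, g x = 0) : LipschitzWith L (s.indicator g) := by
  have key : ∀ x ∈ s, ∀ y ∉ s, dist (g x) 0 ≤ L * dist x y := by
    intro x hx y hy
    obtain ⟨z, hz, hzx⟩ := exists_mem_frontier_dist_le hx hy
    rw [← h0 z hz, dist_comm x y]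
    refine (hg.dist_le_mul x hx z (hs.frontier_subset hz)).trans ?_
    rw [dist_comm x z]
    gcongr
  refine LipschitzWith.of_dist_le_mul fun x y => ?_
  by_cases hx : x ∈ s <;> by_cases hy : y ∈ s
  · simpa [hx, hy] using hg.dist_le_mul x hx y hy
  · simpa [hx, hy] using key x hx y hy
  · simpa [hx, hy, dist_comm] using key y hy x hx
  · simp [hx, hy]; positivity

/-- Integral curves on a compact interval of a uniformly Lipschitz time-dependent vector field
agree as soon as they agree at one point, which may be an endpoint of the interval. -/
lemma IsIntegralCurveOn.eqOn_Icc_of_lipschitzWith {v : ℝ → E → E} {L : ℝ≥0} {a b t₀ : ℝ}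
    (hv : ∀ t ∈ Icc a b, LipschitzWith L (v t)) {y z : ℝ → E}
    (hy : IsIntegralCurveOn y v (Icc a b)) (hz : IsIntegralCurveOn z v (Icc a b))
    (ht₀ : t₀ ∈ Icc a b) (h : y t₀ = z t₀) : EqOn y z (Icc a b) := by
  rw [← Icc_union_Icc_eq_Icc ht₀.1 ht₀.2]
  have hl : Icc a t₀ ⊆ Icc a b := Icc_subset_Icc_right ht₀.2
  have hr : Icc t₀ b ⊆ Icc a b := Icc_subset_Icc_left ht₀.1
  have left {w : ℝ → E} (hw : IsIntegralCurveOn w v (Icc a b)) :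
      ∀ t ∈ Ioc a t₀, HasDerivWithinAt w (v t (w t)) (Iic t) t := fun t ht =>
    (hw t (hl (Ioc_subset_Icc_self ht))).mono_of_mem_nhdsWithin
      (Icc_mem_nhdsLE_of_mem ⟨ht.1, ht.2.trans ht₀.2⟩)
  have right {w : ℝ → E} (hw : IsIntegralCurveOn w v (Icc a b)) :
      ∀ t ∈ Ico t₀ b, HasDerivWithinAt w (v t (w t)) (Ici t) t := fun t ht =>
    (hw t (hr (Ico_subset_Icc_self ht))).mono_of_mem_nhdsWithin
      (Icc_mem_nhdsGE_of_mem ⟨ht₀.1.trans ht.1, ht.2⟩)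
  apply EqOn.union
  · exact ODE_solution_unique_of_mem_Icc_left (s := fun _ => univ)
      (fun t ht => (hv t (hl (Ioc_subset_Icc_self ht))).lipschitzOnWith)
      (hy.continuousOn.mono hl) (left hy) (fun _ _ => mem_univ _)
      (hz.continuousOn.mono hl) (left hz) (fun _ _ => mem_univ _) h
  · exact ODE_solution_unique_of_mem_Icc_right (s := fun _ => univ)
      (fun t ht => (hv t (hr (Ico_subset_Icc_self ht))).lipschitzOnWith)
      (hy.continuousOn.mono hr) (right hy) (fun _ _ => mem_univ _)
      (hz.continuousOn.mono hr) (right hz) (fun _ _ => mem_univ _) h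

/-- A bounded, uniformly Lipschitz vector field on a compact time interval has integral curves
through every point defined on the whole interval. -/
lemma exists_isIntegralCurveOn_Icc_of_lipschitzWith [CompleteSpace E] {v : ℝ → E → E}
    {L M : ℝ≥0} {a b t₀ : ℝ} (hv : ∀ t ∈ Icc a b, LipschitzWith L (v t))
    (hc : ∀ x, ContinuousOn (v · x) (Icc a b)) (hM : ∀ t ∈ Icc a b, ∀ x, ‖v t x‖ ≤ M)
    (ht₀ : t₀ ∈ Icc a b) (x₀ : E) :
    ∃ y : ℝ → E, y t₀ = x₀ ∧ IsIntegralCurveOn y v (Icc a b) := by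
  have hpl : IsPicardLindelof v (⟨t₀, ht₀⟩ : Icc a b) x₀
      (M * (max (b - t₀) (t₀ - a)).toNNReal) 0 M L :=
    { lipschitzOnWith := fun t ht => (hv t ht).lipschitzOnWith
      continuousOn := fun x _ => hc x
      norm_le := fun t ht x _ => hM t ht x
      mul_max_le := by
        have : 0 ≤ max (b - t₀) (t₀ - a) := le_max_of_le_left (sub_nonneg.2 ht₀.2)
        simp [Real.coe_toNNReal _ this] }
  exact hpl.exists_eq_forall_mem_Icc_hasDerivWithinAt₀

/-- Every point of a set `J` of reals has a neighbourhood within `J` which is a compact interval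
with endpoints in `J` and contains a prescribed point of `J`. -/
lemma exists_Icc_mem_nhdsWithin {J : Set ℝ} {t₀ t : ℝ} (ht₀ : t₀ ∈ J) (ht : t ∈ J) :
    ∃ a ∈ J, ∃ b ∈ J, t₀ ∈ Icc a b ∧ t ∈ Icc a b ∧ Icc a b ∈ 𝓝[J] t := by
  obtain ⟨b, hb, hb₀, hbt, hbn⟩ : ∃ b ∈ J, t₀ ≤ b ∧ t ≤ b ∧ Iic b ∈ 𝓝[J] t := by
    by_cases h : ∃ s ∈ J, t < s
    · obtain ⟨s, hs, hts⟩ := h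
      refine ⟨max s t₀, by grind, le_max_right _ _, by grind, ?_⟩
      exact mem_nhdsWithin_of_mem_nhds (Iic_mem_nhds (by grind))
    · refine ⟨t, ht, by grind, le_rfl, ?_⟩
      exact Filter.mem_of_superset self_mem_nhdsWithin fun s hs => by
        simp only [mem_Iic]; grind
  obtain ⟨a, ha, ha₀, hat, han⟩ : ∃ a ∈ J, a ≤ t₀ ∧ a ≤ t ∧ Ici a ∈ 𝓝[J] t := by
    by_cases h : ∃ s ∈ J, s < t
    · obtain ⟨s, hs, hts⟩ := h
      refine ⟨min s t₀, by grind, min_le_right _ _, by grind, ?_⟩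
      exact mem_nhdsWithin_of_mem_nhds (Ici_mem_nhds (by grind))
    · refine ⟨t, ht, by grind, le_rfl, ?_⟩
      exact Filter.mem_of_superset self_mem_nhdsWithin fun s hs => by
        simp only [mem_Ici]; grind
  exact ⟨a, ha, b, hb, ⟨ha₀, hb₀⟩, ⟨hat, hbt⟩, Filter.inter_mem han hbn⟩

/-- A time-dependent vector field on an interval `J` which is bounded and uniformly Lipschitz on
compact subintervals has integral curves through every point defined on all of `J`. -/
lemma Set.OrdConnected.exists_isIntegralCurveOn [CompleteSpace E] {v : ℝ → E → E} {J : Set ℝ}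
    (hJ : J.OrdConnected)
    (hv : ∀ a ∈ J, ∀ b ∈ J, ∃ L : ℝ≥0, ∀ t ∈ Icc a b, LipschitzWith L (v t))
    (hc : ∀ x, ContinuousOn (v · x) J)
    (hM : ∀ a ∈ J, ∀ b ∈ J, ∃ M : ℝ≥0, ∀ t ∈ Icc a b, ∀ x, ‖v t x‖ ≤ M)
    {t₀ : ℝ} (ht₀ : t₀ ∈ J) (x₀ : E) :
    ∃ y : ℝ → E, y t₀ = x₀ ∧ IsIntegralCurveOn y v J := by
  have hex (a b : ℝ) : ∃ y : ℝ → E, a ∈ J → b ∈ J → t₀ ∈ Icc a b →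
      y t₀ = x₀ ∧ IsIntegralCurveOn y v (Icc a b) := by
    by_cases h : a ∈ J ∧ b ∈ J ∧ t₀ ∈ Icc a b
    · obtain ⟨ha, hb, h₀⟩ := h
      obtain ⟨L, hL⟩ := hv a ha b hb
      obtain ⟨M, hM⟩ := hM a ha b hb
      obtain ⟨y, hy⟩ := exists_isIntegralCurveOn_Icc_of_lipschitzWith hL
        (fun x => (hc x).mono (hJ.out ha hb)) hM h₀ x₀
      exact ⟨y, fun _ _ _ => hy⟩
    · exact ⟨0, fun ha hb h₀ => absurd ⟨ha, hb, h₀⟩ h⟩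
  choose Y hY using hex
  let y : ℝ → E := fun t => Y (min t₀ t) (max t₀ t) t
  have hy : ∀ a ∈ J, ∀ b ∈ J, t₀ ∈ Icc a b → EqOn y (Y a b) (Icc a b) := by
    intro a ha b hb h₀ t ht
    have hsub : Icc (min t₀ t) (max t₀ t) ⊆ Icc a b :=
      Icc_subset_Icc (le_min h₀.1 ht.1) (max_le h₀.2 ht.2)
    have htJ : t ∈ J := hJ.out ha hb ht
    have h₀' : t₀ ∈ Icc (min t₀ t) (max t₀ t) := ⟨min_le_left _ _, le_max_left _ _⟩
    obtain ⟨L, hL⟩ := hv a ha b hb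
    obtain ⟨h1, h2⟩ := hY (min t₀ t) (max t₀ t) (by grind) (by grind) h₀'
    obtain ⟨h3, h4⟩ := hY a b ha hb h₀
    exact h2.eqOn_Icc_of_lipschitzWith (fun s hs => hL s (hsub hs)) (h4.mono hsub) h₀'
      (h1.trans h3.symm) ⟨min_le_right _ _, le_max_right _ _⟩
  refine ⟨y, ?_, fun t ht => ?_⟩
  · exact (hY _ _ (by simpa) (by simpa) (by simp)).1
  · obtain ⟨a, ha, b, hb, h₀, htab, hn⟩ := exists_Icc_mem_nhdsWithin ht₀ ht
    have heq := hy a ha b hb h₀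
    have := (hY a b ha hb h₀).2 t htab
    rw [← heq htab] at this
    exact (this.congr_of_mem heq htab).mono_of_mem_nhdsWithin hn

end

/-- Let `J ⊆ ℝ` be a non-degenerate interval, `K ⊆ ℝⁿ` a compact convex set
with non-empty interior, and `f : J × K → ℝⁿ` a continuous map vanishing on
`J × ∂K` which is Lipschitz in the second variable, locally uniformly in
time:  on each compact subinterval `[a,b] ⊆ J` there is a common Lipschitz
constant.  Then for all `t₀ ∈ J` and `x₀ ∈ K` there is a unique
`y : J → K` with `y t₀ = x₀` which solves `y' t = f (t, y t)` on all of
`J`. -/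
theorem exists_unique_global_solution_on_interval
    {n : ℕ} (J : Set ℝ) (hJ : J.OrdConnected)
    (hJnd : ∃ a ∈ J, ∃ b ∈ J, a < b)
    (K : Set (EuclideanSpace ℝ (Fin n)))
    (hK : IsCompact K) (hKconv : Convex ℝ K) (hKint : (interior K).Nonempty)
    (f : ℝ × EuclideanSpace ℝ (Fin n) → EuclideanSpace ℝ (Fin n))
    (hfcont : ContinuousOn f (J ×ˢ K))
    (hfbd : ∀ t ∈ J, ∀ x ∈ frontier K, f (t, x) = 0)
    (hflip : ∀ a ∈ J, ∀ b ∈ J, ∃ L : ℝ, ∀ t ∈ Set.Icc a b, ∀ x ∈ K, ∀ y ∈ K,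
      ‖f (t, y) - f (t, x)‖ ≤ L * ‖y - x‖) :
    ∀ t₀ ∈ J, ∀ x₀ ∈ K, ∃ y : ℝ → EuclideanSpace ℝ (Fin n),
      ((∀ t ∈ J, y t ∈ K) ∧ y t₀ = x₀ ∧
        ∀ t ∈ J, HasDerivWithinAt y (f (t, y t)) J t) ∧
      ∀ z : ℝ → EuclideanSpace ℝ (Fin n),
        ((∀ t ∈ J, z t ∈ K) ∧ z t₀ = x₀ ∧
          ∀ t ∈ J, HasDerivWithinAt z (f (t, z t)) J t) →
        ∀ t ∈ J, z t = y t := by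
  intro t₀ ht₀ x₀ hx₀
  let v : ℝ → EuclideanSpace ℝ (Fin n) → EuclideanSpace ℝ (Fin n) :=
    fun t => K.indicator fun x => f (t, x)
  have hvK (t : ℝ) {x} (hx : x ∈ K) : v t x = f (t, x) := indicator_of_mem hx _
  have hvK' (t : ℝ) {x} (hx : x ∉ K) : v t x = 0 := indicator_of_notMem hx _
  have hv : ∀ a ∈ J, ∀ b ∈ J, ∃ L : ℝ≥0, ∀ t ∈ Icc a b, LipschitzWith L (v t) := by
    intro a ha b hb
    obtain ⟨L, hL⟩ := hflip a ha b hb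
    refine ⟨L.toNNReal, fun t ht => LipschitzOnWith.lipschitzWith_indicator ?_ hK.isClosed
      (hfbd t (hJ.out ha hb ht))⟩
    refine LipschitzOnWith.of_dist_le_mul fun x hx y hy => ?_
    rw [dist_eq_norm, dist_eq_norm]
    exact (hL t ht y hy x hx).trans (by gcongr; exact Real.le_coe_toNNReal L)
  have hc (x) : ContinuousOn (v · x) J := by
    by_cases hx : x ∈ K
    · simp only [hvK _ hx]
      exact hfcont.comp (by fun_prop) fun t ht => ⟨ht, hx⟩
    · simp only [hvK' _ hx]
      exact continuousOn_const
  have hM : ∀ a ∈ J, ∀ b ∈ J, ∃ M : ℝ≥0, ∀ t ∈ Icc a b, ∀ x, ‖v t x‖ ≤ M := by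
    intro a ha b hb
    obtain ⟨C, hC⟩ := (isCompact_Icc.prod hK).exists_bound_of_continuousOn
      (hfcont.mono (prod_mono_left (hJ.out ha hb)))
    refine ⟨C.toNNReal, fun t ht x => ?_⟩
    by_cases hx : x ∈ K
    · rw [hvK t hx]
      exact (hC (t, x) ⟨ht, hx⟩).trans (Real.le_coe_toNNReal C)
    · simp [hvK' t hx]
  have huniq {y z : ℝ → EuclideanSpace ℝ (Fin n)} (hy : IsIntegralCurveOn y v J)
      (hz : IsIntegralCurveOn z v J) {s t : ℝ} (hs : s ∈ J) (ht : t ∈ J) (h : y s = z s) :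
      y t = z t := by
    obtain ⟨a, ha, b, hb, hsab, htab, -⟩ := exists_Icc_mem_nhdsWithin hs ht
    obtain ⟨L, hL⟩ := hv a ha b hb
    exact (hy.mono (hJ.out ha hb)).eqOn_Icc_of_lipschitzWith hL (hz.mono (hJ.out ha hb)) hsab h
      htab
  obtain ⟨y, hy₀, hy⟩ := hJ.exists_isIntegralCurveOn hv hc hM ht₀ x₀
  have hyK : ∀ t ∈ J, y t ∈ K := by
    intro t ht
    by_contra hyt
    have hconst : IsIntegralCurveOn (fun _ => y t) v J := fun s _ => by
      rw [hvK' s hyt]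
      exact hasDerivWithinAt_const _ _ _
    have := huniq hy hconst ht ht₀ rfl
    exact hyt (this ▸ hy₀ ▸ hx₀)
  refine ⟨y, ⟨hyK, hy₀, fun t ht => hvK t (hyK t ht) ▸ hy t ht⟩, ?_⟩
  rintro z ⟨hzK, hz₀, hz⟩ t ht
  have hz' : IsIntegralCurveOn z v J := fun s hs => by
    rw [hvK s (hzK s hs)]
    exact hz s hs
  exact huniq hz' hy ht₀ ht (hz₀.trans hy₀.symm)
end
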